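/- Let H be a bialgebra and (A,μ,λ) a left H-comodule algebra. Define 𝒞^{p,q}(A,H) = C^{p,q}(A) ⊕ C^{p,q+1}(H), where C^{p,q}(A) = Hom(A^{⊗p}, H^{⊗q}⊗A) (with C^{0,q}(A)=0 and C^{1,0}(A)=Der(A)) and C^{p,q}(H) = Hom(H^{⊗p}, H^{⊗q}) is the truncated bialgebra cochain complex, with horizontal and vertical differentials d^h_{p,q}(φ,f) = (∂^h_{p,q}φ, ∂^h_{p,q+1}f) and d^v_{p,q}(φ,f) = (∂^v_{p,q}φ + (−1)^q (f⊗id_A)λ^p₂, ∂^v_{p,q+1}f), where λ^p₂: A^{⊗p} → H^{⊗p}⊗A sends a¹⊗…⊗a^p to a¹₍₋₁₎⊗…⊗a^p₍₋₁₎⊗ a¹₍₀₎…a^p₍₀₎. Then (𝒞^{p,q}(A,H), d^h_{p,q}, (−1)^p d^v_{p,q}) is a bicomplex: d^h∘d^h = 0, d^v∘d^v = 0, and d^h∘d^v = d^v∘d^h. -/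

import Mathlib

open TensorProduct

noncomputable section

namespace HopfPaper

variable (k : Type) [CommRing k]

/-- The image submodule `p ⊗ q ⊆ M ⊗ N` of a pair of submodules. -/
def tsub {M N : Type} [AddCommGroup M] [Module k M] [AddCommGroup N] [Module k N]
    (p : Submodule k M) (q : Submodule k N) : Submodule k (M ⊗[k] N) :=
  LinearMap.range (TensorProduct.mapIncl p q)

/-- A left `H`-comodule algebra structure on the `k`-algebra `A`:
an algebra map `λ : A → H ⊗ A` which is coassociative and counital. -/
structure ComodAlg (H A : Type) [Ring H] [HopfAlgebra k H] [Ring A] [Algebra k A] where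
  lam : A →ₐ[k] H ⊗[k] A
  coassoc : (Coalgebra.comul (R := k) (A := H)).rTensor A ∘ₗ lam.toLinearMap
      = (TensorProduct.assoc k H H A).symm.toLinearMap ∘ₗ
          lam.toLinearMap.lTensor H ∘ₗ lam.toLinearMap
  counital : (Coalgebra.counit (R := k) (A := H)).rTensor A ∘ₗ lam.toLinearMap
      = TensorProduct.mk k k A 1

variable {k}

/-- A right ideal of `A` which is costable under the coaction, i.e. `λ(J) ⊆ H ⊗ J`. -/
def ComodAlg.IsCostableRightIdeal {H A : Type} [Ring H] [HopfAlgebra k H] [Ring A] [Algebra k A]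
    (c : ComodAlg k H A) (J : Submodule k A) : Prop :=
  (∀ j ∈ J, ∀ a : A, j * a ∈ J) ∧
    Submodule.map c.lam.toLinearMap J ≤ tsub k (⊤ : Submodule k H) J

/-- `A` is right `H`-simple: it has no nontrivial `H`-costable right ideal. -/
def ComodAlg.RightSimple {H A : Type} [Ring H] [HopfAlgebra k H] [Ring A] [Algebra k A]
    (c : ComodAlg k H A) : Prop :=
  ∀ J : Submodule k A, c.IsCostableRightIdeal J → J = ⊥ ∨ J = ⊤

/-- The coinvariants of `A` are trivial: `A^{co H} = k`. -/
def ComodAlg.TrivialCoinv {H A : Type} [Ring H] [HopfAlgebra k H] [Ring A] [Algebra k A]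
    (c : ComodAlg k H A) : Prop :=
  ∀ a : A, c.lam a = 1 ⊗ₜ[k] a ↔ ∃ t : k, a = t • (1 : A)

end HopfPaper

set_option maxHeartbeats 1000000
set_option synthInstance.maxHeartbeats 400000

namespace HopfPaper

section Tpow

variable (k : Type) [CommRing k]

/-- Iterated tensor power as a bundled module. -/
def tpowC (V : ModuleCat.{0} k) : ℕ → ModuleCat.{0} k
  | 0 => ModuleCat.of k k
  | n + 1 => ModuleCat.of k ((V : Type) ⊗[k] (tpowC V n : Type))

/-- Iterated tensor power `V^{⊗n}` (left-nested, `V^{⊗0} = k`). -/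
abbrev tpow (V : Type) [AddCommGroup V] [Module k V] (n : ℕ) : Type :=
  tpowC k (ModuleCat.of k V) n

/-- The isomorphism `V^{⊗(p+1)} ≅ V^{⊗p} ⊗ V` splitting off the last tensorand. -/
def splitLast (V : Type) [AddCommGroup V] [Module k V] :
    ∀ p, tpow k V (p + 1) ≃ₗ[k] tpow k V p ⊗[k] V
  | 0 => TensorProduct.comm k V k
  | p + 1 =>
      (TensorProduct.congr (LinearEquiv.refl k V) (splitLast V p)).trans
        (TensorProduct.assoc k V (tpow k V p) V).symm

variable (A : Type) [Ring A] [Algebra k A]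

/-- `m^s_i : A^{⊗(s+1)} → A^{⊗s}`, multiplying the `i`-th and `(i+1)`-th tensorands
(1-indexed, `1 ≤ i ≤ s`; junk value `0` otherwise). -/
def mulAt : ∀ (s i : ℕ), tpow k A (s + 1) →ₗ[k] tpow k A s
  | 0, _ => 0
  | _ + 1, 0 => 0
  | s + 1, 1 =>
      (LinearMap.mul' k A).rTensor (tpow k A s) ∘ₗ
        (TensorProduct.assoc k A A (tpow k A s)).symm.toLinearMap
  | s + 1, i + 2 => (mulAt s (i + 1)).lTensor A

end Tpow

section TpowH

variable (k : Type) [CommRing k] (H : Type) [Ring H] [HopfAlgebra k H]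

/-- `Δ^s_i : H^{⊗s} → H^{⊗(s+1)}`, comultiplying the `i`-th tensorand
(1-indexed, `1 ≤ i ≤ s`; junk value `0` otherwise). -/
def comulAt : ∀ (s i : ℕ), tpow k H s →ₗ[k] tpow k H (s + 1)
  | 0, _ => 0
  | _ + 1, 0 => 0
  | s + 1, 1 =>
      (TensorProduct.assoc k H H (tpow k H s)).toLinearMap ∘ₗ
        (Coalgebra.comul (R := k) (A := H)).rTensor (tpow k H s)
  | s + 1, i + 2 => (comulAt s (i + 1)).lTensor H

/-- The left diagonal action `λ^s_l : H ⊗ H^{⊗s} → H^{⊗s}`,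
`x ⊗ y¹⊗…⊗yˢ ↦ x₁y¹ ⊗ … ⊗ xₛyˢ`. -/
def lact : ∀ s, H ⊗[k] tpow k H s →ₗ[k] tpow k H s
  | 0 => LinearMap.mul' k k ∘ₗ (Coalgebra.counit (R := k) (A := H)).rTensor k
  | s + 1 =>
      TensorProduct.map (LinearMap.mul' k H) (lact s) ∘ₗ
        (TensorProduct.tensorTensorTensorComm k H H H (tpow k H s)).toLinearMap ∘ₗ
        (Coalgebra.comul (R := k) (A := H)).rTensor (H ⊗[k] tpow k H s)

/-- The right diagonal action `λ^s_r : H^{⊗s} ⊗ H → H^{⊗s}`,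
`y¹⊗…⊗yˢ ⊗ x ↦ y¹x₁ ⊗ … ⊗ yˢxₛ`. -/
def ract : ∀ s, tpow k H s ⊗[k] H →ₗ[k] tpow k H s
  | 0 => LinearMap.mul' k k ∘ₗ (Coalgebra.counit (R := k) (A := H)).lTensor k
  | s + 1 =>
      TensorProduct.map (LinearMap.mul' k H) (ract s) ∘ₗ
        (TensorProduct.tensorTensorTensorComm k H (tpow k H s) H H).toLinearMap ∘ₗ
        (Coalgebra.comul (R := k) (A := H)).lTensor (H ⊗[k] tpow k H s)

/-- The left diagonal coaction `δ^s_l : H^{⊗s} → H ⊗ H^{⊗s}`. -/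
def coactl : ∀ s, tpow k H s →ₗ[k] H ⊗[k] tpow k H s
  | 0 => TensorProduct.mk k H (tpow k H 0) 1
  | s + 1 =>
      (LinearMap.mul' k H).rTensor (H ⊗[k] tpow k H s) ∘ₗ
        (TensorProduct.tensorTensorTensorComm k H H H (tpow k H s)).toLinearMap ∘ₗ
        TensorProduct.map (Coalgebra.comul (R := k) (A := H)) (coactl s)

/-- The right diagonal coaction `δ^s_r : H^{⊗s} → H^{⊗s} ⊗ H`. -/
def coactr : ∀ s, tpow k H s →ₗ[k] tpow k H s ⊗[k] H
  | 0 => (TensorProduct.mk k (tpow k H 0) H).flip 1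
  | s + 1 =>
      (LinearMap.mul' k H).lTensor (H ⊗[k] tpow k H s) ∘ₗ
        (TensorProduct.tensorTensorTensorComm k H H (tpow k H s) H).toLinearMap ∘ₗ
        TensorProduct.map (Coalgebra.comul (R := k) (A := H)) (coactr s)

end TpowH

section Bicomplex

variable (k : Type) [CommRing k] (H : Type) [Ring H] [HopfAlgebra k H]
  (A : Type) [Ring A] [Algebra k A] (c : ComodAlg k H A)

/-- The iterated coaction `λ^p₁ : A^{⊗p} → H ⊗ A^{⊗p}`,
`a¹⊗…⊗aᵖ ↦ a¹₍₋₁₎…aᵖ₍₋₁₎ ⊗ a¹₍₀₎⊗…⊗aᵖ₍₀₎`. -/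
def lam1 : ∀ p, tpow k A p →ₗ[k] H ⊗[k] tpow k A p
  | 0 => TensorProduct.mk k H (tpow k A 0) 1
  | p + 1 =>
      (LinearMap.mul' k H).rTensor (A ⊗[k] tpow k A p) ∘ₗ
        (TensorProduct.tensorTensorTensorComm k H A H (tpow k A p)).toLinearMap ∘ₗ
        TensorProduct.map c.lam.toLinearMap (lam1 p)

/-- The iterated coaction `λ^p₂ : A^{⊗p} → H^{⊗p} ⊗ A`,
`a¹⊗…⊗aᵖ ↦ a¹₍₋₁₎⊗…⊗aᵖ₍₋₁₎ ⊗ a¹₍₀₎…aᵖ₍₀₎`. -/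
def lam2 : ∀ p, tpow k A p →ₗ[k] tpow k H p ⊗[k] A
  | 0 => (TensorProduct.mk k (tpow k H 0) A).flip 1
  | p + 1 =>
      (LinearMap.mul' k A).lTensor (H ⊗[k] tpow k H p) ∘ₗ
        (TensorProduct.tensorTensorTensorComm k H A (tpow k H p) A).toLinearMap ∘ₗ
        TensorProduct.map c.lam.toLinearMap (lam2 p)

/-- The left `A`-module structure `β^q_l : A ⊗ (H^{⊗q} ⊗ A) → H^{⊗q} ⊗ A`. -/
def betaL (q : ℕ) : A ⊗[k] (tpow k H q ⊗[k] A) →ₗ[k] tpow k H q ⊗[k] A :=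
  TensorProduct.map (lact k H q) (LinearMap.mul' k A) ∘ₗ
    (TensorProduct.tensorTensorTensorComm k H A (tpow k H q) A).toLinearMap ∘ₗ
    c.lam.toLinearMap.rTensor (tpow k H q ⊗[k] A)

/-- The right `A`-module structure `β^q_r : (H^{⊗q} ⊗ A) ⊗ A → H^{⊗q} ⊗ A`. -/
def betaR (q : ℕ) : (tpow k H q ⊗[k] A) ⊗[k] A →ₗ[k] tpow k H q ⊗[k] A :=
  TensorProduct.map (ract k H q) (LinearMap.mul' k A) ∘ₗ
    (TensorProduct.tensorTensorTensorComm k (tpow k H q) A H A).toLinearMap ∘ₗ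
    c.lam.toLinearMap.lTensor (tpow k H q ⊗[k] A)

/-- The horizontal differential of the comodule-algebra complex `C^{p,q}(A)`. -/
def dhA (p q : ℕ) (f : tpow k A p →ₗ[k] tpow k H q ⊗[k] A) :
    tpow k A (p + 1) →ₗ[k] tpow k H q ⊗[k] A :=
  ∑ i ∈ Finset.range (p + 2), ((-1 : ℤ) ^ i) •
    (if i = 0 then betaL k H A c q ∘ₗ f.lTensor A
     else if i = p + 1 then
       betaR k H A c q ∘ₗ f.rTensor A ∘ₗ (splitLast k A p).toLinearMap
     else f ∘ₗ mulAt k A p i)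

/-- The vertical differential of the comodule-algebra complex `C^{p,q}(A)`. -/
def dvA (p q : ℕ) (f : tpow k A p →ₗ[k] tpow k H q ⊗[k] A) :
    tpow k A p →ₗ[k] tpow k H (q + 1) ⊗[k] A :=
  ∑ i ∈ Finset.range (q + 2), ((-1 : ℤ) ^ i) •
    (if i = 0 then
       (TensorProduct.assoc k H (tpow k H q) A).symm.toLinearMap ∘ₗ
         f.lTensor H ∘ₗ lam1 k H A c p
     else if i = q + 1 then
       ((splitLast k H q).symm.toLinearMap.rTensor A) ∘ₗ
         (TensorProduct.assoc k (tpow k H q) H A).symm.toLinearMap ∘ₗ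
         c.lam.toLinearMap.lTensor (tpow k H q) ∘ₗ f
     else ((comulAt k H q i).rTensor A) ∘ₗ f)

/-- The horizontal differential of the (truncated) bialgebra complex `C^{p,q}(H)`. -/
def dhH (p q : ℕ) (g : tpow k H p →ₗ[k] tpow k H q) :
    tpow k H (p + 1) →ₗ[k] tpow k H q :=
  ∑ i ∈ Finset.range (p + 2), ((-1 : ℤ) ^ i) •
    (if i = 0 then lact k H q ∘ₗ g.lTensor H
     else if i = p + 1 then ract k H q ∘ₗ g.rTensor H ∘ₗ (splitLast k H p).toLinearMap
     else g ∘ₗ mulAt k H p i)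

/-- The vertical differential of the (truncated) bialgebra complex `C^{p,q}(H)`. -/
def dvH (p q : ℕ) (g : tpow k H p →ₗ[k] tpow k H q) :
    tpow k H p →ₗ[k] tpow k H (q + 1) :=
  ∑ i ∈ Finset.range (q + 2), ((-1 : ℤ) ^ i) •
    (if i = 0 then g.lTensor H ∘ₗ coactl k H p
     else if i = q + 1 then
       (splitLast k H q).symm.toLinearMap ∘ₗ g.rTensor H ∘ₗ coactr k H p
     else comulAt k H q i ∘ₗ g)

/-- The deformation bicomplex `𝒞^{p,q}(A,H) = C^{p,q}(A) ⊕ C^{p,q+1}(H)`. -/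
abbrev Cbi (p q : ℕ) : Type :=
  (tpow k A p →ₗ[k] tpow k H q ⊗[k] A) × (tpow k H p →ₗ[k] tpow k H (q + 1))

/-- The horizontal differential of `𝒞^{*,*}(A,H)`. -/
def dh (p q : ℕ) : Cbi k H A p q → Cbi k H A (p + 1) q :=
  fun z => (dhA k H A c p q z.1, dhH k H p (q + 1) z.2)

/-- The vertical differential of `𝒞^{*,*}(A,H)`, with the correction term
`(-1)^q (f ⊗ id_A) ∘ λ^p₂` linking the two columns. -/
def dv (p q : ℕ) : Cbi k H A p q → Cbi k H A p (q + 1) :=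
  fun z => (dvA k H A c p q z.1 + ((-1 : ℤ) ^ q) • (z.2.rTensor A ∘ₗ lam2 k H A c p),
    dvH k H p (q + 1) z.2)

end Bicomplex

section Diagonal

variable {k : Type} [CommRing k]

/-- The diagonal action of `B` on `X ⊗ Y` along `ρ : B → C ⊗ D`, where `C` acts on `X` and
`D` acts on `Y`. Both left and right actions are curried with the acting element first. -/
def diagAct {B C D X Y : Type} [AddCommGroup B] [Module k B] [AddCommGroup C] [Module k C]
    [AddCommGroup D] [Module k D] [AddCommGroup X] [Module k X] [AddCommGroup Y] [Module k Y]
    (ρ : B →ₗ[k] C ⊗[k] D) (L : C →ₗ[k] X →ₗ[k] X) (M : D →ₗ[k] Y →ₗ[k] Y) :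
    B →ₗ[k] (X ⊗[k] Y) →ₗ[k] (X ⊗[k] Y) :=
  TensorProduct.homTensorHomMap (.id k) X Y X Y ∘ₗ TensorProduct.map L M ∘ₗ ρ

/-- `g` intertwines the actions `L` and `L'`. -/
def Equivariant {B X X' : Type} [AddCommGroup B] [Module k B]
    [AddCommGroup X] [Module k X] [AddCommGroup X'] [Module k X']
    (L : B →ₗ[k] X →ₗ[k] X) (L' : B →ₗ[k] X' →ₗ[k] X') (g : X →ₗ[k] X') : Prop :=
  ∀ b x, g (L b x) = L' b (g x)

section

variable {B C D E F X X' Y Y' Z : Type} [AddCommGroup B] [Module k B] [AddCommGroup C] [Module k C]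
  [AddCommGroup D] [Module k D] [AddCommGroup E] [Module k E] [AddCommGroup F] [Module k F]
  [AddCommGroup X] [Module k X] [AddCommGroup Y] [Module k Y]
  [AddCommGroup X'] [Module k X'] [AddCommGroup Y'] [Module k Y'] [AddCommGroup Z] [Module k Z]

theorem Equivariant.comp {L : B →ₗ[k] X →ₗ[k] X} {L' : B →ₗ[k] Y →ₗ[k] Y}
    {L'' : B →ₗ[k] Z →ₗ[k] Z} {g : Y →ₗ[k] Z} {f : X →ₗ[k] Y}
    (hg : Equivariant L' L'' g) (hf : Equivariant L L' f) : Equivariant L L'' (g ∘ₗ f) :=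
  fun b x => by simp [hf b x, hg b (f x)]

theorem Equivariant.id (L : B →ₗ[k] X →ₗ[k] X) : Equivariant L L LinearMap.id := fun _ _ => rfl

theorem Equivariant.symm {L : B →ₗ[k] X →ₗ[k] X} {L' : B →ₗ[k] Y →ₗ[k] Y} {e : X ≃ₗ[k] Y}
    (h : Equivariant L L' e.toLinearMap) : Equivariant L' L e.symm.toLinearMap := fun b y => by
  apply e.injective
  have := h b (e.symm y)
  simp_all

theorem Equivariant.diagAct (ρ : B →ₗ[k] C ⊗[k] D) {L : C →ₗ[k] X →ₗ[k] X}
    {L' : C →ₗ[k] X' →ₗ[k] X'} {M : D →ₗ[k] Y →ₗ[k] Y} {M' : D →ₗ[k] Y' →ₗ[k] Y'}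
    {g : X →ₗ[k] X'} {h : Y →ₗ[k] Y'} (hg : Equivariant L L' g) (hh : Equivariant M M' h) :
    Equivariant (diagAct ρ L M) (diagAct ρ L' M') (TensorProduct.map g h) := fun b x => by
  simp only [HopfPaper.diagAct, LinearMap.comp_apply]
  generalize ρ b = t
  induction t with
  | zero => simp
  | add => simp_all
  | tmul c d =>
    induction x with
    | zero => simp
    | add => simp_all
    | tmul x y => simp [hg c x, hh d y]

/-- Coassociativity of the diagonal action. -/
theorem equivariant_assoc {ρ : B →ₗ[k] C ⊗[k] D} {σ : C →ₗ[k] E ⊗[k] F}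
    {G : Type} [AddCommGroup G] [Module k G] {ρ' : B →ₗ[k] E ⊗[k] G} {σ' : G →ₗ[k] F ⊗[k] D}
    (H : (TensorProduct.assoc k E F D).toLinearMap ∘ₗ σ.rTensor D ∘ₗ ρ = σ'.lTensor E ∘ₗ ρ')
    (L : E →ₗ[k] X →ₗ[k] X) (M : F →ₗ[k] Y →ₗ[k] Y) (N : D →ₗ[k] Z →ₗ[k] Z) :
    Equivariant (diagAct ρ (diagAct σ L M) N) (diagAct ρ' L (diagAct σ' M N))
      (TensorProduct.assoc k X Y Z).toLinearMap := by
  intro b x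
  have key : ∀ (t : C ⊗[k] D) (x : (X ⊗[k] Y) ⊗[k] Z),
      TensorProduct.assoc k X Y Z
        (TensorProduct.homTensorHomMap (.id k) (X ⊗[k] Y) Z (X ⊗[k] Y) Z
          (TensorProduct.map (diagAct σ L M) N t) x) =
      TensorProduct.homTensorHomMap (.id k) X (Y ⊗[k] Z) X (Y ⊗[k] Z)
        (TensorProduct.map L
          (TensorProduct.homTensorHomMap (.id k) Y Z Y Z ∘ₗ TensorProduct.map M N)
          (TensorProduct.assoc k E F D (σ.rTensor D t))) (TensorProduct.assoc k X Y Z x) := by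
    intro t x
    induction t with
    | zero => simp
    | add => simp_all
    | tmul c d =>
      simp only [HopfPaper.diagAct, LinearMap.rTensor_tmul, TensorProduct.map_tmul,
        LinearMap.comp_apply]
      generalize σ c = s
      induction s with
      | zero => simp
      | add => simp_all [TensorProduct.add_tmul]
      | tmul e f =>
        induction x with
        | zero => simp
        | add => simp_all
        | tmul x z =>
          induction x with
          | zero => simp
          | add => simp_all [TensorProduct.add_tmul]
          | tmul x y => simp
  have key' : ∀ (t : E ⊗[k] G) (x : X ⊗[k] (Y ⊗[k] Z)),
      TensorProduct.homTensorHomMap (.id k) X (Y ⊗[k] Z) X (Y ⊗[k] Z)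
        (TensorProduct.map L
          (TensorProduct.homTensorHomMap (.id k) Y Z Y Z ∘ₗ TensorProduct.map M N)
          (σ'.lTensor E t)) x =
      TensorProduct.homTensorHomMap (.id k) X (Y ⊗[k] Z) X (Y ⊗[k] Z)
          (TensorProduct.map L (diagAct σ' M N) t) x := by
    intro t x
    rw [← LinearMap.comp_apply (TensorProduct.map _ _), LinearMap.map_comp_lTensor]
    rfl
  have hb := LinearMap.congr_fun H b
  simp only [LinearMap.comp_apply, LinearEquiv.coe_coe] at hb
  simp only [LinearEquiv.coe_coe]
  refine (key (ρ b) x).trans ?_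
  rw [hb, key']
  rfl

end

section Multiplicative

variable {B C D X Y : Type} [Ring B] [Algebra k B] [Ring C] [Algebra k C] [Ring D] [Algebra k D]
  [AddCommGroup X] [Module k X] [AddCommGroup Y] [Module k Y]

theorem diagAct_mul (ρ : B →ₐ[k] C ⊗[k] D) {L : C →ₗ[k] X →ₗ[k] X} {M : D →ₗ[k] Y →ₗ[k] Y}
    (hL : ∀ a b x, L (a * b) x = L a (L b x)) (hM : ∀ a b x, M (a * b) x = M a (M b x))
    (a b : B) (x : X ⊗[k] Y) :
    diagAct ρ.toLinearMap L M (a * b) x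
      = diagAct ρ.toLinearMap L M a (diagAct ρ.toLinearMap L M b x) := by
  simp only [diagAct, LinearMap.comp_apply, AlgHom.toLinearMap_apply, map_mul]
  generalize ρ a = s
  generalize ρ b = t
  induction s with
  | zero => simp
  | add => simp_all [add_mul]
  | tmul c d =>
    induction t with
    | zero => simp
    | add => simp_all [mul_add]
    | tmul c' d' =>
      induction x with
      | zero => simp
      | add => simp_all
      | tmul x y => simp [hL, hM]

theorem diagAct_mul_rev (ρ : B →ₐ[k] C ⊗[k] D) {L : C →ₗ[k] X →ₗ[k] X} {M : D →ₗ[k] Y →ₗ[k] Y}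
    (hL : ∀ a b x, L (a * b) x = L b (L a x)) (hM : ∀ a b x, M (a * b) x = M b (M a x))
    (a b : B) (x : X ⊗[k] Y) :
    diagAct ρ.toLinearMap L M (a * b) x
      = diagAct ρ.toLinearMap L M b (diagAct ρ.toLinearMap L M a x) := by
  simp only [diagAct, LinearMap.comp_apply, AlgHom.toLinearMap_apply, map_mul]
  generalize ρ a = s
  generalize ρ b = t
  induction s with
  | zero => simp
  | add => simp_all [add_mul]
  | tmul c d =>
    induction t with
    | zero => simp
    | add => simp_all [mul_add]
    | tmul c' d' =>
      induction x with
      | zero => simp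
      | add => simp_all
      | tmul x y => simp [hL, hM]

theorem diagAct_comm (ρ : B →ₗ[k] C ⊗[k] D) {L L' : C →ₗ[k] X →ₗ[k] X} {M M' : D →ₗ[k] Y →ₗ[k] Y}
    (hL : ∀ a b x, L a (L' b x) = L' b (L a x)) (hM : ∀ a b x, M a (M' b x) = M' b (M a x))
    (a b : B) (x : X ⊗[k] Y) :
    diagAct ρ L M a (diagAct ρ L' M' b x) = diagAct ρ L' M' b (diagAct ρ L M a x) := by
  simp only [diagAct, LinearMap.comp_apply]
  generalize ρ a = s
  generalize ρ b = t
  induction s with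
  | zero => simp
  | add => simp_all
  | tmul c d =>
    induction t with
    | zero => simp
    | add => simp_all
    | tmul c' d' =>
      induction x with
      | zero => simp
      | add => simp_all
      | tmul x y => simp [hL, hM]

/-- An algebra map `B → C ⊗ D` intertwines left multiplication with the diagonal action. -/
theorem equivariant_mul (ρ : B →ₐ[k] C ⊗[k] D) :
    Equivariant (LinearMap.mul k B)
      (diagAct ρ.toLinearMap (LinearMap.mul k C) (LinearMap.mul k D)) ρ.toLinearMap := by
  intro a b
  simp only [diagAct, LinearMap.comp_apply, AlgHom.toLinearMap_apply, map_mul,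
    LinearMap.mul_apply']
  generalize ρ a = s
  generalize ρ b = t
  induction s with
  | zero => simp
  | add => simp_all [add_mul]
  | tmul c d =>
    induction t with
    | zero => simp
    | add => simp_all [mul_add]
    | tmul c' d' => simp

theorem equivariant_mul_flip (ρ : B →ₐ[k] C ⊗[k] D) :
    Equivariant (LinearMap.mul k B).flip
      (diagAct ρ.toLinearMap (LinearMap.mul k C).flip (LinearMap.mul k D).flip)
      ρ.toLinearMap := by
  intro a b
  simp only [diagAct, LinearMap.comp_apply, AlgHom.toLinearMap_apply, map_mul,
    LinearMap.mul_apply', LinearMap.flip_apply]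
  generalize ρ a = s
  generalize ρ b = t
  induction s with
  | zero => simp
  | add => simp_all [mul_add]
  | tmul c d =>
    induction t with
    | zero => simp
    | add => simp_all [add_mul]
    | tmul c' d' => simp

end Multiplicative

end Diagonal

section Codiagonal

variable {k : Type} [CommRing k]

section Defs

variable (R : Type) [Ring R] [Algebra k R] {N N' K K' : Type}
  [AddCommGroup N] [Module k N] [AddCommGroup N'] [Module k N']
  [AddCommGroup K'] [Module k K'] [AddCommGroup K] [Module k K]

/-- The codiagonal map `N ⊗ N' → R ⊗ (K ⊗ K')` multiplying the left `R`-components. -/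
def codiagL (l : N →ₗ[k] R ⊗[k] K) (m : N' →ₗ[k] R ⊗[k] K') :
    N ⊗[k] N' →ₗ[k] R ⊗[k] (K ⊗[k] K') :=
  (LinearMap.mul' k R).rTensor (K ⊗[k] K') ∘ₗ
    (TensorProduct.tensorTensorTensorComm k R K R K').toLinearMap ∘ₗ TensorProduct.map l m

/-- The codiagonal map `N ⊗ N' → (K ⊗ K') ⊗ R` multiplying the right `R`-components. -/
def codiagR (l : N →ₗ[k] K ⊗[k] R) (m : N' →ₗ[k] K' ⊗[k] R) :
    N ⊗[k] N' →ₗ[k] (K ⊗[k] K') ⊗[k] R :=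
  (LinearMap.mul' k R).lTensor (K ⊗[k] K') ∘ₗ
    (TensorProduct.tensorTensorTensorComm k K R K' R).toLinearMap ∘ₗ TensorProduct.map l m

end Defs

section

variable {R : Type} [Ring R] [Algebra k R] {N N' N'' K K' K'' J J' : Type}
  [AddCommGroup N] [Module k N] [AddCommGroup N'] [Module k N']
  [AddCommGroup N''] [Module k N'']
  [AddCommGroup K] [Module k K] [AddCommGroup K'] [Module k K']
  [AddCommGroup K''] [Module k K'']
  [AddCommGroup J] [Module k J] [AddCommGroup J'] [Module k J']

theorem lTensor_map_codiagL (l : N →ₗ[k] R ⊗[k] K) (l' : N' →ₗ[k] R ⊗[k] K')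
    (g : K →ₗ[k] J) (g' : K' →ₗ[k] J') :
    (TensorProduct.map g g').lTensor R ∘ₗ codiagL R l l'
      = codiagL R (g.lTensor R ∘ₗ l) (g'.lTensor R ∘ₗ l') := by
  refine TensorProduct.ext' fun x y => ?_
  simp only [codiagL, LinearMap.comp_apply, TensorProduct.map_tmul, LinearEquiv.coe_coe]
  generalize l x = s
  generalize l' y = t
  induction s with
  | zero => simp
  | add => simp_all [add_tmul]
  | tmul c d =>
    induction t with
    | zero => simp
    | add => simp_all [tmul_add]
    | tmul c' d' => simp

theorem rTensor_map_codiagR (l : N →ₗ[k] K ⊗[k] R) (l' : N' →ₗ[k] K' ⊗[k] R)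
    (g : K →ₗ[k] J) (g' : K' →ₗ[k] J') :
    (TensorProduct.map g g').rTensor R ∘ₗ codiagR R l l'
      = codiagR R (g.rTensor R ∘ₗ l) (g'.rTensor R ∘ₗ l') := by
  refine TensorProduct.ext' fun x y => ?_
  simp only [codiagR, LinearMap.comp_apply, TensorProduct.map_tmul, LinearEquiv.coe_coe]
  generalize l x = s
  generalize l' y = t
  induction s with
  | zero => simp
  | add => simp_all [add_tmul]
  | tmul c d =>
    induction t with
    | zero => simp
    | add => simp_all [tmul_add]
    | tmul c' d' => simp

theorem codiagL_comp_map (l : N →ₗ[k] R ⊗[k] K) (l' : N' →ₗ[k] R ⊗[k] K')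
    (g : J →ₗ[k] N) (g' : J' →ₗ[k] N') :
    codiagL R l l' ∘ₗ TensorProduct.map g g' = codiagL R (l ∘ₗ g) (l' ∘ₗ g') := by
  ext; simp [codiagL]

theorem codiagR_comp_map (l : N →ₗ[k] K ⊗[k] R) (l' : N' →ₗ[k] K' ⊗[k] R)
    (g : J →ₗ[k] N) (g' : J' →ₗ[k] N') :
    codiagR R l l' ∘ₗ TensorProduct.map g g' = codiagR R (l ∘ₗ g) (l' ∘ₗ g') := by
  ext; simp [codiagR]

theorem codiagL_assoc (l : N →ₗ[k] R ⊗[k] K) (l' : N' →ₗ[k] R ⊗[k] K')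
    (l'' : N'' →ₗ[k] R ⊗[k] K'') :
    (TensorProduct.assoc k K K' K'').toLinearMap.lTensor R ∘ₗ codiagL R (codiagL R l l') l''
      = codiagL R l (codiagL R l' l'') ∘ₗ (TensorProduct.assoc k N N' N'').toLinearMap := by
  refine TensorProduct.ext_threefold fun x y z => ?_
  simp only [codiagL, LinearMap.comp_apply, TensorProduct.map_tmul, LinearEquiv.coe_coe,
    TensorProduct.assoc_tmul]
  generalize l x = s
  generalize l' y = t
  generalize l'' z = u
  induction s with
  | zero => simp
  | add => simp_all [add_tmul]
  | tmul c d =>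
    induction t with
    | zero => simp
    | add => simp_all [tmul_add, add_tmul]
    | tmul c' d' =>
      induction u with
      | zero => simp
      | add => simp_all [tmul_add]
      | tmul c'' d'' => simp [mul_assoc]

theorem codiagR_assoc (l : N →ₗ[k] K ⊗[k] R) (l' : N' →ₗ[k] K' ⊗[k] R)
    (l'' : N'' →ₗ[k] K'' ⊗[k] R) :
    (TensorProduct.assoc k K K' K'').toLinearMap.rTensor R ∘ₗ codiagR R (codiagR R l l') l''
      = codiagR R l (codiagR R l' l'') ∘ₗ (TensorProduct.assoc k N N' N'').toLinearMap := by
  refine TensorProduct.ext_threefold fun x y z => ?_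
  simp only [codiagR, LinearMap.comp_apply, TensorProduct.map_tmul, LinearEquiv.coe_coe,
    TensorProduct.assoc_tmul]
  generalize l x = s
  generalize l' y = t
  generalize l'' z = u
  induction s with
  | zero => simp
  | add => simp_all [add_tmul]
  | tmul c d =>
    induction t with
    | zero => simp
    | add => simp_all [tmul_add, add_tmul]
    | tmul c' d' =>
      induction u with
      | zero => simp
      | add => simp_all [tmul_add]
      | tmul c'' d'' => simp [mul_assoc]

end

section Compatibility

variable {H A : Type} [Ring H] [Algebra k H] [Ring A] [Algebra k A] {N N' K K' : Type}
  [AddCommGroup N] [Module k N] [AddCommGroup N'] [Module k N']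
  [AddCommGroup K'] [Module k K'] [AddCommGroup K] [Module k K]

/-- Codiagonal left coactions are coassociative. -/
theorem codiagL_coassoc (Δ : H →ₐ[k] H ⊗[k] H) {l : N →ₗ[k] H ⊗[k] N} {l' : N' →ₗ[k] H ⊗[k] N'}
    (hl : (TensorProduct.assoc k H H N).toLinearMap ∘ₗ Δ.toLinearMap.rTensor N ∘ₗ l
      = l.lTensor H ∘ₗ l)
    (hl' : (TensorProduct.assoc k H H N').toLinearMap ∘ₗ Δ.toLinearMap.rTensor N' ∘ₗ l'
      = l'.lTensor H ∘ₗ l') :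
    (TensorProduct.assoc k H H (N ⊗[k] N')).toLinearMap ∘ₗ
        Δ.toLinearMap.rTensor (N ⊗[k] N') ∘ₗ codiagL H l l'
      = (codiagL H l l').lTensor H ∘ₗ codiagL H l l' := by
  have hR : ∀ (s : H ⊗[k] N) (t : H ⊗[k] N'),
      (codiagL H l l').lTensor H (codiagL H LinearMap.id LinearMap.id (s ⊗ₜ[k] t)) =
      (codiagL H LinearMap.id LinearMap.id).lTensor H
        (codiagL H LinearMap.id LinearMap.id (l.lTensor H s ⊗ₜ[k] l'.lTensor H t)) := by
    intro s t
    induction s with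
    | zero => simp
    | add => simp_all [add_tmul]
    | tmul c d =>
      induction t with
      | zero => simp
      | add => simp_all [tmul_add]
      | tmul c' d' => simp [codiagL]
  have hL : ∀ (s : H ⊗[k] N) (t : H ⊗[k] N'),
      TensorProduct.assoc k H H (N ⊗[k] N') (Δ.toLinearMap.rTensor (N ⊗[k] N')
        (codiagL H LinearMap.id LinearMap.id (s ⊗ₜ[k] t))) =
      (codiagL H LinearMap.id LinearMap.id).lTensor H
        (codiagL H LinearMap.id LinearMap.id
          (TensorProduct.assoc k H H N (Δ.toLinearMap.rTensor N s) ⊗ₜ[k]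
            TensorProduct.assoc k H H N' (Δ.toLinearMap.rTensor N' t))) := by
    intro s t
    induction s with
    | zero => simp
    | add => simp_all [add_tmul]
    | tmul c d =>
      induction t with
      | zero => simp
      | add => simp_all [tmul_add]
      | tmul c' d' =>
        simp only [codiagL, LinearMap.comp_apply, TensorProduct.map_tmul, LinearEquiv.coe_coe,
          AlgHom.toLinearMap_apply, LinearMap.mul'_apply, map_mul, LinearMap.rTensor_tmul,
          LinearMap.id_apply, TensorProduct.tensorTensorTensorComm_tmul]
        generalize Δ c = u
        generalize Δ c' = v
        induction u with
        | zero => simp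
        | add => simp_all [add_tmul, add_mul]
        | tmul u u' =>
          induction v with
          | zero => simp
          | add => simp_all [tmul_add, add_tmul, mul_add]
          | tmul v v' => simp
  refine TensorProduct.ext' fun x y => ?_
  have hx := LinearMap.congr_fun hl x
  have hy := LinearMap.congr_fun hl' y
  simp only [LinearMap.comp_apply, LinearEquiv.coe_coe] at hx hy
  have h1 := hL (l x) (l' y)
  rw [hx, hy, ← hR] at h1
  exact h1

/-- Compatibility of the two codiagonal coactions of a tensor product. -/
theorem codiag_compat {m : N →ₗ[k] K ⊗[k] A} {m' : N' →ₗ[k] K' ⊗[k] A}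
    {l : N →ₗ[k] H ⊗[k] N} {l' : N' →ₗ[k] H ⊗[k] N'}
    {d : K →ₗ[k] H ⊗[k] K} {d' : K' →ₗ[k] H ⊗[k] K'}
    (hm : (TensorProduct.assoc k H K A).toLinearMap ∘ₗ d.rTensor A ∘ₗ m = m.lTensor H ∘ₗ l)
    (hm' : (TensorProduct.assoc k H K' A).toLinearMap ∘ₗ d'.rTensor A ∘ₗ m'
      = m'.lTensor H ∘ₗ l') :
    (TensorProduct.assoc k H (K ⊗[k] K') A).toLinearMap ∘ₗ
        (codiagL H d d').rTensor A ∘ₗ codiagR A m m'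
      = (codiagR A m m').lTensor H ∘ₗ codiagL H l l' := by
  have hR : ∀ (s : H ⊗[k] N) (t : H ⊗[k] N'),
      (codiagR A m m').lTensor H (codiagL H LinearMap.id LinearMap.id (s ⊗ₜ[k] t)) =
      (codiagR A LinearMap.id LinearMap.id).lTensor H
        (codiagL H LinearMap.id LinearMap.id (m.lTensor H s ⊗ₜ[k] m'.lTensor H t)) := by
    intro s t
    induction s with
    | zero => simp
    | add => simp_all [add_tmul]
    | tmul c d =>
      induction t with
      | zero => simp
      | add => simp_all [tmul_add]
      | tmul c' d' => simp [codiagL, codiagR]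
  have hL : ∀ (s : K ⊗[k] A) (t : K' ⊗[k] A),
      TensorProduct.assoc k H (K ⊗[k] K') A ((codiagL H d d').rTensor A
        (codiagR A LinearMap.id LinearMap.id (s ⊗ₜ[k] t))) =
      (codiagR A LinearMap.id LinearMap.id).lTensor H
        (codiagL H LinearMap.id LinearMap.id
          (TensorProduct.assoc k H K A (d.rTensor A s) ⊗ₜ[k]
            TensorProduct.assoc k H K' A (d'.rTensor A t))) := by
    intro s t
    induction s with
    | zero => simp
    | add => simp_all [add_tmul]
    | tmul x a =>
      induction t with
      | zero => simp
      | add => simp_all [tmul_add]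
      | tmul x' a' =>
        simp only [codiagL, codiagR, LinearMap.comp_apply, TensorProduct.map_tmul,
          LinearEquiv.coe_coe, LinearMap.mul'_apply, LinearMap.rTensor_tmul,
          LinearMap.lTensor_tmul,
          LinearMap.id_apply, TensorProduct.tensorTensorTensorComm_tmul]
        generalize d x = u
        generalize d' x' = v
        induction u with
        | zero => simp
        | add => simp_all [add_tmul]
        | tmul u u' =>
          induction v with
          | zero => simp
          | add => simp_all [tmul_add, add_tmul]
          | tmul v v' => simp
  refine TensorProduct.ext' fun x y => ?_
  have hx := LinearMap.congr_fun hm x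
  have hy := LinearMap.congr_fun hm' y
  simp only [LinearMap.comp_apply, LinearEquiv.coe_coe] at hx hy
  have h1 := hL (m x) (m' y)
  rw [hx, hy, ← hR] at h1
  exact h1

/-- Codiagonal coactions are compatible with an algebra coaction on the last factor. -/
theorem codiagR_coassoc (ρ : A →ₐ[k] H ⊗[k] A) {m : N →ₗ[k] K ⊗[k] A} {m' : N' →ₗ[k] K' ⊗[k] A}
    {r : K →ₗ[k] K ⊗[k] H} {r' : K' →ₗ[k] K' ⊗[k] H}
    (hm : (TensorProduct.assoc k K H A).toLinearMap ∘ₗ r.rTensor A ∘ₗ m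
      = ρ.toLinearMap.lTensor K ∘ₗ m)
    (hm' : (TensorProduct.assoc k K' H A).toLinearMap ∘ₗ r'.rTensor A ∘ₗ m'
      = ρ.toLinearMap.lTensor K' ∘ₗ m') :
    (TensorProduct.assoc k (K ⊗[k] K') H A).toLinearMap ∘ₗ
        (codiagR H r r').rTensor A ∘ₗ codiagR A m m'
      = ρ.toLinearMap.lTensor (K ⊗[k] K') ∘ₗ codiagR A m m' := by
  have hR : ∀ (s : K ⊗[k] A) (t : K' ⊗[k] A),
      ρ.toLinearMap.lTensor (K ⊗[k] K') (codiagR A LinearMap.id LinearMap.id (s ⊗ₜ[k] t)) =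
      codiagR (H ⊗[k] A) (ρ.toLinearMap.lTensor K) (ρ.toLinearMap.lTensor K') (s ⊗ₜ[k] t) := by
    intro s t
    induction s with
    | zero => simp
    | add => simp_all [add_tmul]
    | tmul c d =>
      induction t with
      | zero => simp
      | add => simp_all [tmul_add]
      | tmul c' d' => simp [codiagR]
  have hL : ∀ (s : K ⊗[k] A) (t : K' ⊗[k] A),
      TensorProduct.assoc k (K ⊗[k] K') H A ((codiagR H r r').rTensor A
        (codiagR A LinearMap.id LinearMap.id (s ⊗ₜ[k] t))) =
      codiagR (H ⊗[k] A) LinearMap.id LinearMap.id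
        (TensorProduct.assoc k K H A (r.rTensor A s) ⊗ₜ[k]
          TensorProduct.assoc k K' H A (r'.rTensor A t)) := by
    intro s t
    induction s with
    | zero => simp
    | add => simp_all [add_tmul]
    | tmul x a =>
      induction t with
      | zero => simp
      | add => simp_all [tmul_add]
      | tmul x' a' =>
        simp only [codiagR, LinearMap.comp_apply, TensorProduct.map_tmul,
          LinearEquiv.coe_coe, LinearMap.mul'_apply, LinearMap.rTensor_tmul,
          LinearMap.lTensor_tmul,
          LinearMap.id_apply, TensorProduct.tensorTensorTensorComm_tmul]
        generalize r x = u
        generalize r' x' = v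
        induction u with
        | zero => simp
        | add => simp_all [add_tmul]
        | tmul u u' =>
          induction v with
          | zero => simp
          | add => simp_all [tmul_add, add_tmul]
          | tmul v v' => simp
  refine TensorProduct.ext' fun x y => ?_
  have hx := LinearMap.congr_fun hm x
  have hy := LinearMap.congr_fun hm' y
  simp only [LinearMap.comp_apply, LinearEquiv.coe_coe] at hx hy
  have h1 := hL (m x) (m' y)
  rw [hx, hy] at h1
  exact h1.trans (hR (m x) (m' y)).symm

end Compatibility

section Coefficients

variable {H A : Type} [Ring H] [Algebra k H] [Ring A] [Algebra k A] {B N K X Y : Type}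
  [AddCommGroup B] [Module k B]
  [AddCommGroup N] [Module k N] [AddCommGroup K] [Module k K]
  [AddCommGroup X] [Module k X] [AddCommGroup Y] [Module k Y]

theorem lift_lTensor_codiagL (ρ : B →ₗ[k] H ⊗[k] B) (l : N →ₗ[k] H ⊗[k] N) (f : N →ₗ[k] Y)
    (L : B →ₗ[k] Y →ₗ[k] Y) :
    (TensorProduct.lift L ∘ₗ f.lTensor B).lTensor H ∘ₗ codiagL H ρ l
      = TensorProduct.lift (diagAct ρ (LinearMap.mul k H) L) ∘ₗ (f.lTensor H ∘ₗ l).lTensor B := by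
  refine TensorProduct.ext' fun x y => ?_
  simp only [codiagL, diagAct, LinearMap.comp_apply, TensorProduct.map_tmul, LinearEquiv.coe_coe,
    TensorProduct.lift.tmul, LinearMap.lTensor_tmul]
  generalize ρ x = s
  generalize l y = t
  induction s with
  | zero => simp
  | add => simp_all [add_tmul]
  | tmul c d =>
    induction t with
    | zero => simp
    | add => simp_all [tmul_add]
    | tmul c' d' => simp

theorem lift_rTensor_codiagL (ρ : B →ₗ[k] H ⊗[k] B) (l : N →ₗ[k] H ⊗[k] N) (f : N →ₗ[k] Y)
    (L : B →ₗ[k] Y →ₗ[k] Y) :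
    (TensorProduct.lift L.flip ∘ₗ f.rTensor B).lTensor H ∘ₗ codiagL H l ρ
      = TensorProduct.lift (diagAct ρ (LinearMap.mul k H).flip L).flip ∘ₗ
        (f.lTensor H ∘ₗ l).rTensor B := by
  refine TensorProduct.ext' fun y x => ?_
  simp only [codiagL, diagAct, LinearMap.comp_apply, TensorProduct.map_tmul, LinearEquiv.coe_coe,
    TensorProduct.lift.tmul, LinearMap.rTensor_tmul, LinearMap.flip_apply]
  generalize ρ x = s
  generalize l y = t
  induction s with
  | zero => simp
  | add => simp_all [tmul_add]
  | tmul c d =>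
    induction t with
    | zero => simp
    | add => simp_all [add_tmul]
    | tmul c' d' => simp

theorem lift_lTensor_codiagR (ρ : A →ₗ[k] H ⊗[k] A) (m : N →ₗ[k] K ⊗[k] A) (g : K →ₗ[k] X)
    (L : H →ₗ[k] X →ₗ[k] X) :
    (TensorProduct.lift L ∘ₗ g.lTensor H).rTensor A ∘ₗ codiagR A ρ m
      = TensorProduct.lift (diagAct ρ L (LinearMap.mul k A)) ∘ₗ (g.rTensor A ∘ₗ m).lTensor A := by
  refine TensorProduct.ext' fun x y => ?_
  simp only [codiagR, diagAct, LinearMap.comp_apply, TensorProduct.map_tmul, LinearEquiv.coe_coe,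
    TensorProduct.lift.tmul, LinearMap.lTensor_tmul]
  generalize ρ x = s
  generalize m y = t
  induction s with
  | zero => simp
  | add => simp_all [add_tmul]
  | tmul c d =>
    induction t with
    | zero => simp
    | add => simp_all [tmul_add]
    | tmul c' d' => simp

theorem lift_rTensor_codiagR (ρ : A →ₗ[k] H ⊗[k] A) (m : N →ₗ[k] K ⊗[k] A) (g : K →ₗ[k] X)
    (L : H →ₗ[k] X →ₗ[k] X) :
    (TensorProduct.lift L.flip ∘ₗ g.rTensor H).rTensor A ∘ₗ codiagR A m ρ
      = TensorProduct.lift (diagAct ρ L (LinearMap.mul k A).flip).flip ∘ₗ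
        (g.rTensor A ∘ₗ m).rTensor A := by
  refine TensorProduct.ext' fun y x => ?_
  simp only [codiagR, diagAct, LinearMap.comp_apply, TensorProduct.map_tmul, LinearEquiv.coe_coe,
    TensorProduct.lift.tmul, LinearMap.rTensor_tmul, LinearMap.flip_apply]
  generalize ρ x = s
  generalize m y = t
  induction s with
  | zero => simp
  | add => simp_all [tmul_add]
  | tmul c d =>
    induction t with
    | zero => simp
    | add => simp_all [add_tmul]
    | tmul c' d' => simp

end Coefficients

end Codiagonal

section DiagonalLift

variable {k : Type} [CommRing k] {B C D X Y Z : Type} [AddCommGroup B] [Module k B]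
  [AddCommGroup C] [Module k C] [AddCommGroup D] [Module k D]
  [AddCommGroup X] [Module k X] [AddCommGroup Y] [Module k Y] [AddCommGroup Z] [Module k Z]

theorem lift_diagAct (ρ : B →ₗ[k] C ⊗[k] D) (L : C →ₗ[k] X →ₗ[k] X) (M : D →ₗ[k] Y →ₗ[k] Y) :
    TensorProduct.map (TensorProduct.lift L) (TensorProduct.lift M) ∘ₗ
      (TensorProduct.tensorTensorTensorComm k C D X Y).toLinearMap ∘ₗ ρ.rTensor (X ⊗[k] Y)
      = TensorProduct.lift (diagAct ρ L M) := by
  refine TensorProduct.ext' fun b x => ?_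
  simp only [diagAct, LinearMap.comp_apply, LinearEquiv.coe_coe, TensorProduct.lift.tmul,
    LinearMap.rTensor_tmul]
  generalize ρ b = t
  induction t with
  | zero => simp
  | add => simp_all [add_tmul]
  | tmul c d =>
    induction x with
    | zero => simp
    | add => simp_all [tmul_add]
    | tmul x y => simp

theorem lift_diagAct_flip (ρ : B →ₗ[k] C ⊗[k] D) (L : C →ₗ[k] X →ₗ[k] X)
    (M : D →ₗ[k] Y →ₗ[k] Y) :
    TensorProduct.map (TensorProduct.lift L.flip) (TensorProduct.lift M.flip) ∘ₗ
      (TensorProduct.tensorTensorTensorComm k X Y C D).toLinearMap ∘ₗ ρ.lTensor (X ⊗[k] Y)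
      = TensorProduct.lift (diagAct ρ L M).flip := by
  refine TensorProduct.ext' fun x b => ?_
  simp only [diagAct, LinearMap.comp_apply, LinearEquiv.coe_coe, TensorProduct.lift.tmul,
    LinearMap.lTensor_tmul, LinearMap.flip_apply]
  generalize ρ b = t
  induction t with
  | zero => simp
  | add => simp_all [tmul_add]
  | tmul c d =>
    induction x with
    | zero => simp
    | add => simp_all [add_tmul]
    | tmul x y => simp

theorem Equivariant.lift_comp_lTensor {L : B →ₗ[k] X →ₗ[k] X} {L' : B →ₗ[k] Y →ₗ[k] Y}
    {g : X →ₗ[k] Y} (h : Equivariant L L' g) (f : Z →ₗ[k] X) :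
    TensorProduct.lift L' ∘ₗ (g ∘ₗ f).lTensor B = g ∘ₗ TensorProduct.lift L ∘ₗ f.lTensor B := by
  ext b z
  simpa using (h b (f z)).symm

theorem Equivariant.lift_comp_rTensor {L : B →ₗ[k] X →ₗ[k] X} {L' : B →ₗ[k] Y →ₗ[k] Y}
    {g : X →ₗ[k] Y} (h : Equivariant L L' g) (f : Z →ₗ[k] X) :
    TensorProduct.lift L'.flip ∘ₗ (g ∘ₗ f).rTensor B
      = g ∘ₗ TensorProduct.lift L.flip ∘ₗ f.rTensor B := by
  ext z b
  simpa using (h b (f z)).symm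

end DiagonalLift

section TensorPowerAction

variable (k : Type) [CommRing k] (H : Type) [Ring H] [HopfAlgebra k H]

/-- The left diagonal action of `H` on `H^{⊗s}`, curried. -/
def leftAct : ∀ s, H →ₗ[k] tpow k H s →ₗ[k] tpow k H s
  | 0 => LinearMap.mul k k ∘ₗ Coalgebra.counit (R := k) (A := H)
  | s + 1 => diagAct (Coalgebra.comul (R := k) (A := H)) (LinearMap.mul k H) (leftAct s)

/-- The right diagonal action of `H` on `H^{⊗s}`, curried with the acting element first. -/
def rightAct : ∀ s, H →ₗ[k] tpow k H s →ₗ[k] tpow k H s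
  | 0 => LinearMap.mul k k ∘ₗ Coalgebra.counit (R := k) (A := H)
  | s + 1 => diagAct (Coalgebra.comul (R := k) (A := H)) (LinearMap.mul k H).flip (rightAct s)

theorem lact_eq_lift : ∀ s, lact k H s = TensorProduct.lift (leftAct k H s)
  | 0 => TensorProduct.ext' fun (x : H) (y : k) => by
      change LinearMap.mul' k k ((Coalgebra.counit (R := k) (A := H)).rTensor k (x ⊗ₜ y))
        = Coalgebra.counit (R := k) x * y
      simp
  | s + 1 => by
      have h := lift_diagAct (Coalgebra.comul (R := k) (A := H)) (LinearMap.mul k H)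
        (leftAct k H s)
      rw [← lact_eq_lift s] at h
      exact h

theorem ract_eq_lift : ∀ s, ract k H s = TensorProduct.lift (rightAct k H s).flip
  | 0 => TensorProduct.ext' fun (y : k) (x : H) => by
      change LinearMap.mul' k k ((Coalgebra.counit (R := k) (A := H)).lTensor k (y ⊗ₜ x))
        = Coalgebra.counit (R := k) x * y
      simp [mul_comm]
  | s + 1 => by
      have h := lift_diagAct_flip (Coalgebra.comul (R := k) (A := H)) (LinearMap.mul k H).flip
        (rightAct k H s)
      rw [← ract_eq_lift s] at h
      exact h

theorem leftAct_mul : ∀ s (a b : H) (x : tpow k H s),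
    leftAct k H s (a * b) x = leftAct k H s a (leftAct k H s b x)
  | 0 => fun a b (x : k) => by
      change Coalgebra.counit (R := k) (a * b) * x
        = Coalgebra.counit (R := k) a * (Coalgebra.counit (R := k) b * x)
      rw [Bialgebra.counit_mul, mul_assoc]
  | s + 1 => diagAct_mul (Bialgebra.comulAlgHom k H) (fun a b x => mul_assoc a b x)
      (leftAct_mul s)

theorem rightAct_mul : ∀ s (a b : H) (x : tpow k H s),
    rightAct k H s (a * b) x = rightAct k H s b (rightAct k H s a x)
  | 0 => fun a b (x : k) => by
      change Coalgebra.counit (R := k) (a * b) * x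
        = Coalgebra.counit (R := k) b * (Coalgebra.counit (R := k) a * x)
      rw [Bialgebra.counit_mul]
      ring
  | s + 1 => diagAct_mul_rev (Bialgebra.comulAlgHom k H)
      (fun a b x => (mul_assoc (x : H) a b).symm) (rightAct_mul s)

theorem leftAct_rightAct : ∀ s (a b : H) (x : tpow k H s),
    leftAct k H s a (rightAct k H s b x) = rightAct k H s b (leftAct k H s a x)
  | 0 => fun a b (x : k) =>
      mul_left_comm (Coalgebra.counit (R := k) a) (Coalgebra.counit (R := k) b) x
  | s + 1 => diagAct_comm _ (fun a b x => (mul_assoc a (x : H) b).symm) (leftAct_rightAct s)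

theorem comul_coassoc_assoc :
    (TensorProduct.assoc k H H H).toLinearMap ∘ₗ
      (Coalgebra.comul (R := k) (A := H)).rTensor H ∘ₗ Coalgebra.comul (R := k) (A := H)
      = (Coalgebra.comul (R := k) (A := H)).lTensor H ∘ₗ Coalgebra.comul (R := k) (A := H) :=
  Coalgebra.coassoc

section Comm

variable {k H} {X : Type} [AddCommGroup X] [Module k X]

theorem equivariant_comm (L : H →ₗ[k] X →ₗ[k] X) :
    Equivariant
      (diagAct (Coalgebra.comul (R := k) (A := H)) L
        (LinearMap.mul k k ∘ₗ Coalgebra.counit (R := k) (A := H)))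
      (diagAct (Coalgebra.comul (R := k) (A := H))
        (LinearMap.mul k k ∘ₗ Coalgebra.counit (R := k) (A := H)) L)
      (TensorProduct.comm k X k).toLinearMap := by
  have hr : ∀ (t : H ⊗[k] H) (x : X) (r : k),
      TensorProduct.homTensorHomMap (.id k) X k X k (TensorProduct.map L
        (LinearMap.mul k k ∘ₗ Coalgebra.counit (R := k) (A := H)) t) (x ⊗ₜ[k] r)
      = L (TensorProduct.rid k H ((Coalgebra.counit (R := k) (A := H)).lTensor H t)) x
        ⊗ₜ[k] r := by
    intro t x r
    induction t with
    | zero => simp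
    | add => simp_all [add_tmul]
    | tmul c d => simp [TensorProduct.smul_tmul]
  have hl : ∀ (t : H ⊗[k] H) (x : X) (r : k),
      TensorProduct.homTensorHomMap (.id k) k X k X (TensorProduct.map
        (LinearMap.mul k k ∘ₗ Coalgebra.counit (R := k) (A := H)) L t) (r ⊗ₜ[k] x)
      = r ⊗ₜ[k] L (TensorProduct.lid k H ((Coalgebra.counit (R := k) (A := H)).rTensor H t)) x
        := by
    intro t x r
    induction t with
    | zero => simp
    | add => simp_all [tmul_add]
    | tmul c d => simp [TensorProduct.smul_tmul']
  intro b x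
  induction x with
  | zero => simp
  | add => simp_all
  | tmul x r =>
    simp only [diagAct, LinearMap.comp_apply, LinearEquiv.coe_coe, TensorProduct.comm_tmul]
    rw [hl, hr]
    simp

end Comm

theorem equivariant_splitLast_leftAct : ∀ s, Equivariant (leftAct k H (s + 1))
    (diagAct (Coalgebra.comul (R := k) (A := H)) (leftAct k H s) (LinearMap.mul k H))
    (splitLast k H s).toLinearMap
  | 0 => equivariant_comm _
  | s + 1 => by
      have h1 := Equivariant.diagAct (Coalgebra.comul (R := k) (A := H))
        (Equivariant.id (LinearMap.mul k H)) (equivariant_splitLast_leftAct s)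
      have h2 := (equivariant_assoc (comul_coassoc_assoc k H) (LinearMap.mul k H)
        (leftAct k H s) (LinearMap.mul k H)).symm
      exact h2.comp h1

theorem equivariant_splitLast_rightAct : ∀ s, Equivariant (rightAct k H (s + 1))
    (diagAct (Coalgebra.comul (R := k) (A := H)) (rightAct k H s) (LinearMap.mul k H).flip)
    (splitLast k H s).toLinearMap
  | 0 => equivariant_comm _
  | s + 1 => by
      have h1 := Equivariant.diagAct (Coalgebra.comul (R := k) (A := H))
        (Equivariant.id (LinearMap.mul k H).flip) (equivariant_splitLast_rightAct s)
      have h2 := (equivariant_assoc (comul_coassoc_assoc k H) (LinearMap.mul k H).flip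
        (rightAct k H s) (LinearMap.mul k H).flip).symm
      exact h2.comp h1

theorem equivariant_comulAt_leftAct : ∀ s i,
    Equivariant (leftAct k H s) (leftAct k H (s + 1)) (comulAt k H s i)
  | 0, _ => fun b x => by simp [comulAt]
  | s + 1, 0 => fun b x => by simp [comulAt]
  | s + 1, 1 =>
      (equivariant_assoc (comul_coassoc_assoc k H) (LinearMap.mul k H) (LinearMap.mul k H)
        (leftAct k H s)).comp
      (Equivariant.diagAct (Coalgebra.comul (R := k) (A := H))
        (equivariant_mul (Bialgebra.comulAlgHom k H)) (Equivariant.id (leftAct k H s)))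
  | s + 1, i + 2 => Equivariant.diagAct (Coalgebra.comul (R := k) (A := H))
      (Equivariant.id (LinearMap.mul k H)) (equivariant_comulAt_leftAct s (i + 1))

theorem equivariant_comulAt_rightAct : ∀ s i,
    Equivariant (rightAct k H s) (rightAct k H (s + 1)) (comulAt k H s i)
  | 0, _ => fun b x => by simp [comulAt]
  | s + 1, 0 => fun b x => by simp [comulAt]
  | s + 1, 1 =>
      (equivariant_assoc (comul_coassoc_assoc k H) (LinearMap.mul k H).flip
        (LinearMap.mul k H).flip (rightAct k H s)).comp
      (Equivariant.diagAct (Coalgebra.comul (R := k) (A := H))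
        (equivariant_mul_flip (Bialgebra.comulAlgHom k H)) (Equivariant.id (rightAct k H s)))
  | s + 1, i + 2 => Equivariant.diagAct (Coalgebra.comul (R := k) (A := H))
      (Equivariant.id (LinearMap.mul k H).flip) (equivariant_comulAt_rightAct s (i + 1))

end TensorPowerAction

section CoefficientAction

variable (k : Type) [CommRing k] (H : Type) [Ring H] [HopfAlgebra k H]
  (A : Type) [Ring A] [Algebra k A] (c : ComodAlg k H A)

/-- The left `A`-action on `H^{⊗q} ⊗ A`, curried. -/
def leftActA (q : ℕ) : A →ₗ[k] (tpow k H q ⊗[k] A) →ₗ[k] (tpow k H q ⊗[k] A) :=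
  diagAct c.lam.toLinearMap (leftAct k H q) (LinearMap.mul k A)

/-- The right `A`-action on `H^{⊗q} ⊗ A`, curried with the acting element first. -/
def rightActA (q : ℕ) : A →ₗ[k] (tpow k H q ⊗[k] A) →ₗ[k] (tpow k H q ⊗[k] A) :=
  diagAct c.lam.toLinearMap (rightAct k H q) (LinearMap.mul k A).flip

/-- The last coface `H^{⊗q} ⊗ A → H^{⊗(q+1)} ⊗ A`, applying the coaction to `A`. -/
def lastCoface (q : ℕ) : tpow k H q ⊗[k] A →ₗ[k] tpow k H (q + 1) ⊗[k] A :=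
  (splitLast k H q).symm.toLinearMap.rTensor A ∘ₗ
    (TensorProduct.assoc k (tpow k H q) H A).symm.toLinearMap ∘ₗ
      c.lam.toLinearMap.lTensor (tpow k H q)

theorem betaL_eq_lift (q : ℕ) : betaL k H A c q = TensorProduct.lift (leftActA k H A c q) := by
  have h := lift_diagAct c.lam.toLinearMap (leftAct k H q) (LinearMap.mul k A)
  rw [← lact_eq_lift] at h
  exact h

theorem betaR_eq_lift (q : ℕ) :
    betaR k H A c q = TensorProduct.lift (rightActA k H A c q).flip := by
  have h := lift_diagAct_flip c.lam.toLinearMap (rightAct k H q) (LinearMap.mul k A).flip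
  rw [← ract_eq_lift] at h
  exact h

theorem leftActA_mul (q : ℕ) (a b : A) (x : tpow k H q ⊗[k] A) :
    leftActA k H A c q (a * b) x = leftActA k H A c q a (leftActA k H A c q b x) :=
  diagAct_mul c.lam (leftAct_mul k H q) (fun a b x => mul_assoc a b x) a b x

theorem rightActA_mul (q : ℕ) (a b : A) (x : tpow k H q ⊗[k] A) :
    rightActA k H A c q (a * b) x = rightActA k H A c q b (rightActA k H A c q a x) :=
  diagAct_mul_rev c.lam (rightAct_mul k H q) (fun a b x => (mul_assoc (x : A) a b).symm) a b x

theorem leftActA_rightActA (q : ℕ) (a b : A) (x : tpow k H q ⊗[k] A) :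
    leftActA k H A c q a (rightActA k H A c q b x)
      = rightActA k H A c q b (leftActA k H A c q a x) :=
  diagAct_comm _ (leftAct_rightAct k H q) (fun a b x => (mul_assoc a (x : A) b).symm) a b x

variable {k H A}

theorem ComodAlg.coassoc_assoc :
    (TensorProduct.assoc k H H A).toLinearMap ∘ₗ
      (Coalgebra.comul (R := k) (A := H)).rTensor A ∘ₗ c.lam.toLinearMap
      = c.lam.toLinearMap.lTensor H ∘ₗ c.lam.toLinearMap := by
  rw [c.coassoc]
  ext; simp

variable (k H A)

theorem equivariant_assoc_leftActA (q : ℕ) :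
    Equivariant (leftActA k H A c (q + 1))
      (diagAct c.lam.toLinearMap (LinearMap.mul k H) (leftActA k H A c q))
      (TensorProduct.assoc k H (tpow k H q) A).toLinearMap :=
  equivariant_assoc c.coassoc_assoc _ _ _

theorem equivariant_assoc_rightActA (q : ℕ) :
    Equivariant (rightActA k H A c (q + 1))
      (diagAct c.lam.toLinearMap (LinearMap.mul k H).flip (rightActA k H A c q))
      (TensorProduct.assoc k H (tpow k H q) A).toLinearMap :=
  equivariant_assoc c.coassoc_assoc _ _ _

theorem equivariant_comulAt_leftActA (q i : ℕ) :
    Equivariant (leftActA k H A c q) (leftActA k H A c (q + 1)) ((comulAt k H q i).rTensor A) :=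
  Equivariant.diagAct _ (equivariant_comulAt_leftAct k H q i) (Equivariant.id _)

theorem equivariant_comulAt_rightActA (q i : ℕ) :
    Equivariant (rightActA k H A c q) (rightActA k H A c (q + 1)) ((comulAt k H q i).rTensor A) :=
  Equivariant.diagAct _ (equivariant_comulAt_rightAct k H q i) (Equivariant.id _)

theorem equivariant_lastCoface_leftActA (q : ℕ) :
    Equivariant (leftActA k H A c q) (leftActA k H A c (q + 1)) (lastCoface k H A c q) :=
  ((Equivariant.diagAct _ (equivariant_splitLast_leftAct k H q).symm (Equivariant.id _)).comp
    (equivariant_assoc c.coassoc_assoc _ _ _).symm).comp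
    (Equivariant.diagAct _ (Equivariant.id _) (equivariant_mul c.lam))

theorem equivariant_lastCoface_rightActA (q : ℕ) :
    Equivariant (rightActA k H A c q) (rightActA k H A c (q + 1)) (lastCoface k H A c q) :=
  ((Equivariant.diagAct _ (equivariant_splitLast_rightAct k H q).symm (Equivariant.id _)).comp
    (equivariant_assoc c.coassoc_assoc _ _ _).symm).comp
    (Equivariant.diagAct _ (Equivariant.id _) (equivariant_mul_flip c.lam))

end CoefficientAction

section MultiplicationFaces

variable {k : Type} [CommRing k] (A : Type) [Ring A] [Algebra k A]

/-- Multiplication of the first two tensorands of `A ⊗ (A ⊗ M)`. -/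
def mulHead (M : Type) [AddCommGroup M] [Module k M] : A ⊗[k] (A ⊗[k] M) →ₗ[k] A ⊗[k] M :=
  (LinearMap.mul' k A).rTensor M ∘ₗ (TensorProduct.assoc k A A M).symm.toLinearMap

section

variable {M N P : Type} [AddCommGroup M] [Module k M] [AddCommGroup N] [Module k N]
  [AddCommGroup P] [Module k P]

theorem mulHead_mulHead :
    mulHead A M ∘ₗ (mulHead A M).lTensor A = mulHead A M ∘ₗ mulHead A (A ⊗[k] M) := by
  ext; simp [mulHead, mul_assoc]

theorem mulHead_natural (g : M →ₗ[k] N) :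
    mulHead A N ∘ₗ (g.lTensor A).lTensor A = g.lTensor A ∘ₗ mulHead A M := by
  ext; simp [mulHead]

/-- One step of the recursion defining `splitLast`. -/
def splitStep {V : Type} [AddCommGroup V] [Module k V] (e : N ≃ₗ[k] M ⊗[k] V) :
    V ⊗[k] N ≃ₗ[k] (V ⊗[k] M) ⊗[k] V :=
  (TensorProduct.congr (LinearEquiv.refl k V) e).trans (TensorProduct.assoc k V M V).symm

theorem splitStep_natural {V M' N' : Type} [AddCommGroup V] [Module k V]
    [AddCommGroup M'] [Module k M'] [AddCommGroup N'] [Module k N']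
    {e : N ≃ₗ[k] M ⊗[k] V} {e' : N' ≃ₗ[k] M' ⊗[k] V} {f : N →ₗ[k] N'} {g : M →ₗ[k] M'}
    (h : e'.toLinearMap ∘ₗ f = g.rTensor V ∘ₗ e.toLinearMap) :
    (splitStep e').toLinearMap ∘ₗ f.lTensor V
      = (g.lTensor V).rTensor V ∘ₗ (splitStep e).toLinearMap := by
  refine TensorProduct.ext' fun v n => ?_
  have hn := LinearMap.congr_fun h n
  simp only [LinearMap.comp_apply, LinearEquiv.coe_coe] at hn
  simp only [splitStep, LinearMap.comp_apply, LinearEquiv.coe_coe, LinearMap.lTensor_tmul,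
    LinearEquiv.trans_apply, TensorProduct.congr_tmul, LinearEquiv.refl_apply, hn]
  generalize e n = t
  induction t with
  | zero => simp
  | add => simp_all [tmul_add]
  | tmul => simp

theorem splitStep_mulHead (e : N ≃ₗ[k] M ⊗[k] A) :
    (splitStep e).toLinearMap ∘ₗ mulHead A N
      = (mulHead A M).rTensor A ∘ₗ (splitStep (splitStep e)).toLinearMap := by
  refine TensorProduct.ext' fun a x => ?_
  induction x with
  | zero => simp
  | add => simp_all [tmul_add]
  | tmul b n =>
    simp only [splitStep, mulHead, LinearMap.comp_apply, LinearEquiv.coe_coe,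
      TensorProduct.assoc_symm_tmul, LinearMap.rTensor_tmul, LinearMap.mul'_apply,
      LinearEquiv.trans_apply, TensorProduct.congr_tmul, LinearEquiv.refl_apply]
    generalize e n = t
    induction t with
    | zero => simp
    | add => simp_all [tmul_add]
    | tmul => simp

theorem splitStep_mulLast {e : N ≃ₗ[k] M ⊗[k] A} {e' : P ≃ₗ[k] N ⊗[k] A} {f : P →ₗ[k] N}
    (h : e.toLinearMap ∘ₗ f = (LinearMap.mul' k A).lTensor M ∘ₗ
      (TensorProduct.assoc k M A A).toLinearMap ∘ₗ e.toLinearMap.rTensor A ∘ₗ e'.toLinearMap) :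
    (splitStep e).toLinearMap ∘ₗ f.lTensor A = (LinearMap.mul' k A).lTensor (A ⊗[k] M) ∘ₗ
      (TensorProduct.assoc k (A ⊗[k] M) A A).toLinearMap ∘ₗ (splitStep e).toLinearMap.rTensor A ∘ₗ
        (splitStep e').toLinearMap := by
  refine TensorProduct.ext' fun v n => ?_
  have hn := LinearMap.congr_fun h n
  simp only [LinearMap.comp_apply, LinearEquiv.coe_coe] at hn
  simp only [splitStep, LinearMap.comp_apply, LinearEquiv.coe_coe, LinearMap.lTensor_tmul,
    LinearEquiv.trans_apply, TensorProduct.congr_tmul, LinearEquiv.refl_apply, hn]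
  generalize e' n = t
  induction t with
  | zero => simp
  | add => simp_all [tmul_add]
  | tmul x a =>
    simp only [LinearMap.rTensor_tmul, LinearEquiv.coe_coe, TensorProduct.assoc_symm_tmul,
      LinearEquiv.trans_apply, TensorProduct.congr_tmul, LinearEquiv.refl_apply]
    generalize e x = t
    induction t with
    | zero => simp
    | add => simp_all [tmul_add, add_tmul]
    | tmul => simp

end

variable (k)

theorem mulAt_mulAt : ∀ s a b : ℕ, a ≤ b → b < s →
    mulAt k A s (a + 1) ∘ₗ mulAt k A (s + 1) (b + 2)
      = mulAt k A s (b + 1) ∘ₗ mulAt k A (s + 1) (a + 1)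
  | 0, _, _, _, hb => absurd hb (by omega)
  | s + 1, 0, 0, _, _ => mulHead_mulHead A (M := tpow k A s)
  | s + 1, 0, b + 1, _, hb => by
      obtain ⟨s, rfl⟩ : ∃ t, s = t + 1 := ⟨s - 1, by omega⟩
      exact mulHead_natural A (mulAt k A (s + 1) (b + 1))
  | s + 1, a + 1, 0, hab, _ => absurd hab (by omega)
  | s + 1, a + 1, b + 1, hab, hb => by
      have h := congrArg (LinearMap.lTensor A)
        (mulAt_mulAt s a b (by omega) (by omega))
      rw [LinearMap.lTensor_comp, LinearMap.lTensor_comp] at h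
      exact h

theorem splitLast_mulAt : ∀ s a : ℕ, a < s →
    (splitLast k A s).toLinearMap ∘ₗ mulAt k A (s + 1) (a + 1)
      = (mulAt k A s (a + 1)).rTensor A ∘ₗ (splitLast k A (s + 1)).toLinearMap
  | 0, _, h => absurd h (by omega)
  | s + 1, 0, _ => splitStep_mulHead A (splitLast k A s)
  | s + 1, a + 1, h => splitStep_natural (splitLast_mulAt s a (by omega))

theorem splitLast_mulAt_last : ∀ s : ℕ,
    (splitLast k A s).toLinearMap ∘ₗ mulAt k A (s + 1) (s + 1)
      = (LinearMap.mul' k A).lTensor (tpow k A s) ∘ₗ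
        (TensorProduct.assoc k (tpow k A s) A A).toLinearMap ∘ₗ
        (splitLast k A s).toLinearMap.rTensor A ∘ₗ (splitLast k A (s + 1)).toLinearMap
  | 0 => by
      have h : (TensorProduct.comm k A k).toLinearMap ∘ₗ mulHead A k
        = (LinearMap.mul' k A).lTensor k ∘ₗ (TensorProduct.assoc k k A A).toLinearMap ∘ₗ
        (TensorProduct.comm k A k).toLinearMap.rTensor A ∘ₗ
        (splitStep (TensorProduct.comm k A k)).toLinearMap := by
        ext; simp [mulHead, splitStep]
      exact h
  | s + 1 => splitStep_mulLast A (splitLast_mulAt_last s)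

end MultiplicationFaces

section ComultiplicationFaces

variable {k : Type} [CommRing k] (H : Type) [Ring H] [HopfAlgebra k H]

/-- Comultiplication of the first tensorand of `H ⊗ M`. -/
def comulHead (M : Type) [AddCommGroup M] [Module k M] : H ⊗[k] M →ₗ[k] H ⊗[k] (H ⊗[k] M) :=
  (TensorProduct.assoc k H H M).toLinearMap ∘ₗ (Coalgebra.comul (R := k) (A := H)).rTensor M

section

variable {M N P : Type} [AddCommGroup M] [Module k M] [AddCommGroup N] [Module k N]
  [AddCommGroup P] [Module k P]

theorem comulHead_comulHead :
    (comulHead H M).lTensor H ∘ₗ comulHead H M = comulHead H (H ⊗[k] M) ∘ₗ comulHead H M := by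
  refine TensorProduct.ext' fun h m => ?_
  have hL : ∀ t : H ⊗[k] H, (comulHead H M).lTensor H (TensorProduct.assoc k H H M (t ⊗ₜ[k] m)) =
      (TensorProduct.assoc k H H M).toLinearMap.lTensor H (TensorProduct.assoc k H (H ⊗[k] H) M
        ((Coalgebra.comul (R := k) (A := H)).lTensor H t ⊗ₜ[k] m)) := by
    intro t
    induction t with
    | zero => simp
    | add => simp_all [add_tmul]
    | tmul => simp [comulHead]
  have hR : ∀ t : H ⊗[k] H, comulHead H (H ⊗[k] M) (TensorProduct.assoc k H H M (t ⊗ₜ[k] m)) =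
      (TensorProduct.assoc k H H M).toLinearMap.lTensor H (TensorProduct.assoc k H (H ⊗[k] H) M
        (TensorProduct.assoc k H H H
          ((Coalgebra.comul (R := k) (A := H)).rTensor H t) ⊗ₜ[k] m)) := by
    intro t
    induction t with
    | zero => simp
    | add => simp_all [add_tmul]
    | tmul x y =>
      simp only [comulHead, LinearMap.comp_apply, LinearEquiv.coe_coe, TensorProduct.assoc_tmul,
        LinearMap.rTensor_tmul]
      generalize Coalgebra.comul (R := k) x = u
      induction u with
      | zero => simp
      | add => simp_all [add_tmul]
      | tmul => simp
  have h1 := LinearMap.congr_fun (comul_coassoc_assoc k H) h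
  simp only [LinearMap.comp_apply, LinearEquiv.coe_coe] at h1
  have h2 := hR (Coalgebra.comul (R := k) h)
  rw [h1, ← hL] at h2
  exact h2.symm

theorem comulHead_natural (g : M →ₗ[k] N) :
    (g.lTensor H).lTensor H ∘ₗ comulHead H M = comulHead H N ∘ₗ g.lTensor H := by
  refine TensorProduct.ext' fun h m => ?_
  simp only [comulHead, LinearMap.comp_apply, LinearEquiv.coe_coe, LinearMap.lTensor_tmul,
    LinearMap.rTensor_tmul]
  generalize Coalgebra.comul (R := k) h = u
  induction u with
  | zero => simp
  | add => simp_all [add_tmul]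
  | tmul => simp

theorem splitStep_comulHead (e : N ≃ₗ[k] M ⊗[k] H) :
    (splitStep (splitStep e)).toLinearMap ∘ₗ comulHead H N
      = (comulHead H M).rTensor H ∘ₗ (splitStep e).toLinearMap := by
  refine TensorProduct.ext' fun h n => ?_
  obtain ⟨t, rfl⟩ : ∃ t, n = e.symm t := ⟨e n, by simp⟩
  induction t with
  | zero => simp
  | add => simp_all [tmul_add]
  | tmul m x =>
    simp only [splitStep, comulHead, LinearMap.comp_apply, LinearEquiv.coe_coe,
      LinearMap.rTensor_tmul, LinearEquiv.trans_apply, TensorProduct.congr_tmul,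
      LinearEquiv.refl_apply, LinearEquiv.apply_symm_apply, TensorProduct.assoc_symm_tmul]
    generalize Coalgebra.comul (R := k) h = u
    induction u with
    | zero => simp
    | add => simp_all [add_tmul]
    | tmul => simp

theorem splitStep_comulLast {e : N ≃ₗ[k] M ⊗[k] H} {e' : P ≃ₗ[k] N ⊗[k] H} {f : N →ₗ[k] P}
    (h : e'.toLinearMap ∘ₗ f = e.symm.toLinearMap.rTensor H ∘ₗ
      (TensorProduct.assoc k M H H).symm.toLinearMap ∘ₗ
      (Coalgebra.comul (R := k) (A := H)).lTensor M ∘ₗ e.toLinearMap) :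
    (splitStep e').toLinearMap ∘ₗ f.lTensor H = (splitStep e).symm.toLinearMap.rTensor H ∘ₗ
      (TensorProduct.assoc k (H ⊗[k] M) H H).symm.toLinearMap ∘ₗ
      (Coalgebra.comul (R := k) (A := H)).lTensor (H ⊗[k] M) ∘ₗ (splitStep e).toLinearMap := by
  refine TensorProduct.ext' fun v n => ?_
  have hn := LinearMap.congr_fun h n
  simp only [LinearMap.comp_apply, LinearEquiv.coe_coe] at hn
  simp only [splitStep, LinearMap.comp_apply, LinearEquiv.coe_coe, LinearMap.lTensor_tmul,
    LinearEquiv.trans_apply, TensorProduct.congr_tmul, LinearEquiv.refl_apply, hn]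
  generalize e n = t
  induction t with
  | zero => simp
  | add => simp_all [tmul_add]
  | tmul x a =>
    simp only [LinearMap.lTensor_tmul, TensorProduct.assoc_symm_tmul]
    generalize Coalgebra.comul (R := k) a = t
    induction t with
    | zero => simp
    | add => simp_all [tmul_add]
    | tmul => simp

end

variable (k)

theorem comulAt_comulAt : ∀ s a b : ℕ, a ≤ b → b < s →
    comulAt k H (s + 1) (b + 2) ∘ₗ comulAt k H s (a + 1)
      = comulAt k H (s + 1) (a + 1) ∘ₗ comulAt k H s (b + 1)
  | 0, _, _, _, hb => absurd hb (by omega)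
  | s + 1, 0, 0, _, _ => comulHead_comulHead H (M := tpow k H s)
  | s + 1, 0, b + 1, _, hb => by
      obtain ⟨s, rfl⟩ : ∃ t, s = t + 1 := ⟨s - 1, by omega⟩
      exact comulHead_natural H (comulAt k H (s + 1) (b + 1))
  | s + 1, a + 1, 0, hab, _ => absurd hab (by omega)
  | s + 1, a + 1, b + 1, hab, hb => by
      have h := congrArg (LinearMap.lTensor H)
        (comulAt_comulAt s a b (by omega) (by omega))
      rw [LinearMap.lTensor_comp, LinearMap.lTensor_comp] at h
      exact h

theorem splitLast_comulAt : ∀ s a : ℕ, a < s →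
    (splitLast k H (s + 1)).toLinearMap ∘ₗ comulAt k H (s + 1) (a + 1)
      = (comulAt k H s (a + 1)).rTensor H ∘ₗ (splitLast k H s).toLinearMap
  | 0, _, h => absurd h (by omega)
  | s + 1, 0, _ => splitStep_comulHead H (splitLast k H s)
  | s + 1, a + 1, h => splitStep_natural (splitLast_comulAt s a (by omega))

theorem splitLast_comulAt_last : ∀ s : ℕ,
    (splitLast k H (s + 1)).toLinearMap ∘ₗ comulAt k H (s + 1) (s + 1)
      = (splitLast k H s).symm.toLinearMap.rTensor H ∘ₗ
        (TensorProduct.assoc k (tpow k H s) H H).symm.toLinearMap ∘ₗ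
        (Coalgebra.comul (R := k) (A := H)).lTensor (tpow k H s) ∘ₗ (splitLast k H s).toLinearMap
  | 0 => by
      have h : (splitStep (TensorProduct.comm k H k)).toLinearMap ∘ₗ comulHead H k
        = (TensorProduct.comm k H k).symm.toLinearMap.rTensor H ∘ₗ
        (TensorProduct.assoc k k H H).symm.toLinearMap ∘ₗ
        (Coalgebra.comul (R := k) (A := H)).lTensor k ∘ₗ
        (TensorProduct.comm k H k).toLinearMap := by
        refine TensorProduct.ext' fun h r => ?_
        simp only [comulHead, LinearMap.comp_apply, LinearEquiv.coe_coe, LinearMap.lTensor_tmul,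
          LinearMap.rTensor_tmul, TensorProduct.comm_tmul]
        generalize Coalgebra.comul (R := k) h = u
        induction u with
        | zero => simp
        | add => simp_all [add_tmul, tmul_add]
        | tmul => simp [splitStep]
      exact h
  | s + 1 => splitStep_comulLast H (splitLast_comulAt_last s)

end ComultiplicationFaces

section CodiagonalSplit

variable {k : Type} [CommRing k] {C A : Type} [Ring C] [Algebra k C] [Ring A] [Algebra k A]
  {M N K K' : Type} [AddCommGroup M] [Module k M] [AddCommGroup N] [Module k N]
  [AddCommGroup K] [Module k K] [AddCommGroup K'] [Module k K']

theorem splitStep_codiagL {ρ : A →ₗ[k] C ⊗[k] A} {l : M →ₗ[k] C ⊗[k] M} {l' : N →ₗ[k] C ⊗[k] N}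
    {e : N ≃ₗ[k] M ⊗[k] A} (h : e.toLinearMap.lTensor C ∘ₗ l' = codiagL C l ρ ∘ₗ e.toLinearMap) :
    (splitStep e).toLinearMap.lTensor C ∘ₗ codiagL C ρ l'
      = codiagL C (codiagL C ρ l) ρ ∘ₗ (splitStep e).toLinearMap := by
  have h1 := lTensor_map_codiagL ρ l' LinearMap.id e.toLinearMap
  rw [LinearMap.lTensor_id, LinearMap.id_comp, h] at h1
  have h2 := codiagL_comp_map ρ (codiagL C l ρ) LinearMap.id e.toLinearMap
  rw [LinearMap.comp_id] at h2
  have h3 := codiagL_assoc ρ l ρ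
  refine LinearMap.ext fun x => ?_
  have h4 := LinearMap.congr_fun (h1.trans h2.symm) x
  have h5 := LinearMap.congr_fun h3 ((splitStep e) x)
  have h6 : splitStep e x = (TensorProduct.assoc k A M A).symm
      (TensorProduct.map LinearMap.id e.toLinearMap x) := rfl
  have h7 : (splitStep e).toLinearMap = (TensorProduct.assoc k A M A).symm.toLinearMap ∘ₗ
      TensorProduct.map LinearMap.id e.toLinearMap := rfl
  have hinj : Function.Injective ((TensorProduct.assoc k A M A).toLinearMap.lTensor C) :=
    (LinearEquiv.lTensor C (TensorProduct.assoc k A M A)).injective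
  apply hinj
  simp only [LinearMap.comp_apply, LinearEquiv.coe_coe] at h4 h5 ⊢
  rw [h5, h6, LinearEquiv.apply_symm_apply, ← h4, h7, LinearMap.lTensor_comp, LinearMap.comp_apply,
    ← LinearMap.comp_apply, ← LinearMap.lTensor_comp]
  simp

theorem splitStep_codiagR {ρ : A →ₗ[k] C ⊗[k] A} {m : M →ₗ[k] K ⊗[k] A} {m' : N →ₗ[k] K' ⊗[k] A}
    {e : N ≃ₗ[k] M ⊗[k] A} {e' : K' ≃ₗ[k] K ⊗[k] C}
    (h : e'.toLinearMap.rTensor A ∘ₗ m' = codiagR A m ρ ∘ₗ e.toLinearMap) :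
    (splitStep e').toLinearMap.rTensor A ∘ₗ codiagR A ρ m'
      = codiagR A (codiagR A ρ m) ρ ∘ₗ (splitStep e).toLinearMap := by
  have h1 := rTensor_map_codiagR ρ m' LinearMap.id e'.toLinearMap
  rw [LinearMap.rTensor_id, LinearMap.id_comp, h] at h1
  have h2 := codiagR_comp_map ρ (codiagR A m ρ) LinearMap.id e.toLinearMap
  rw [LinearMap.comp_id] at h2
  have h3 := codiagR_assoc ρ m ρ
  refine LinearMap.ext fun x => ?_
  have h4 := LinearMap.congr_fun (h1.trans h2.symm) x
  have h5 := LinearMap.congr_fun h3 ((splitStep e) x)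
  have h6 : splitStep e x = (TensorProduct.assoc k A M A).symm
      (TensorProduct.map LinearMap.id e.toLinearMap x) := rfl
  have h7 : (splitStep e').toLinearMap = (TensorProduct.assoc k C K C).symm.toLinearMap ∘ₗ
      TensorProduct.map LinearMap.id e'.toLinearMap := rfl
  have hinj : Function.Injective ((TensorProduct.assoc k C K C).toLinearMap.rTensor A) :=
    (LinearEquiv.rTensor A (TensorProduct.assoc k C K C)).injective
  apply hinj
  simp only [LinearMap.comp_apply, LinearEquiv.coe_coe] at h4 h5 ⊢
  rw [h5, h6, LinearEquiv.apply_symm_apply, ← h4, h7, LinearMap.rTensor_comp, LinearMap.comp_apply,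
    ← LinearMap.comp_apply, ← LinearMap.rTensor_comp]
  simp

theorem codiagL_mulHead (ρ : A →ₐ[k] C ⊗[k] A) (l : M →ₗ[k] C ⊗[k] M) :
    codiagL C ρ.toLinearMap l ∘ₗ mulHead A M
      = (mulHead A M).lTensor C ∘ₗ codiagL C ρ.toLinearMap (codiagL C ρ.toLinearMap l) := by
  refine TensorProduct.ext' fun a x => ?_
  induction x with
  | zero => simp
  | add => simp_all [tmul_add]
  | tmul b m =>
    simp only [codiagL, mulHead, LinearMap.comp_apply, LinearEquiv.coe_coe,
      TensorProduct.assoc_symm_tmul, LinearMap.rTensor_tmul, LinearMap.mul'_apply,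
      TensorProduct.map_tmul, AlgHom.toLinearMap_apply, map_mul]
    generalize ρ a = s
    generalize ρ b = t
    generalize l m = u
    induction s with
    | zero => simp
    | add => simp_all [add_tmul, add_mul]
    | tmul c d =>
      induction t with
      | zero => simp
      | add => simp_all [tmul_add, add_tmul, mul_add]
      | tmul c' d' =>
        induction u with
        | zero => simp
        | add => simp_all [tmul_add]
        | tmul c'' d'' => simp [mul_assoc]

theorem codiagR_mulHead (ρ : A →ₐ[k] C ⊗[k] A) (m : M →ₗ[k] K ⊗[k] A) :
    codiagR A ρ.toLinearMap m ∘ₗ mulHead A M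
      = (mulHead C K).rTensor A ∘ₗ codiagR A ρ.toLinearMap (codiagR A ρ.toLinearMap m) := by
  refine TensorProduct.ext' fun a x => ?_
  induction x with
  | zero => simp
  | add => simp_all [tmul_add]
  | tmul b y =>
    simp only [codiagR, mulHead, LinearMap.comp_apply, LinearEquiv.coe_coe,
      TensorProduct.assoc_symm_tmul, LinearMap.rTensor_tmul, LinearMap.mul'_apply,
      TensorProduct.map_tmul, AlgHom.toLinearMap_apply, map_mul]
    generalize ρ a = s
    generalize ρ b = t
    generalize m y = u
    induction s with
    | zero => simp
    | add => simp_all [add_tmul, add_mul]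
    | tmul c d =>
      induction t with
      | zero => simp
      | add => simp_all [tmul_add, add_tmul, mul_add]
      | tmul c' d' =>
        induction u with
        | zero => simp
        | add => simp_all [tmul_add]
        | tmul c'' d'' => simp [mul_assoc]

end CodiagonalSplit

section IteratedCoactions

variable (k : Type) [CommRing k] (H : Type) [Ring H] [HopfAlgebra k H]
  (A : Type) [Ring A] [Algebra k A] (c : ComodAlg k H A)

theorem lam1_coassoc : ∀ p,
    (TensorProduct.assoc k H H (tpow k A p)).toLinearMap ∘ₗ
      (Coalgebra.comul (R := k) (A := H)).rTensor (tpow k A p) ∘ₗ lam1 k H A c p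
      = (lam1 k H A c p).lTensor H ∘ₗ lam1 k H A c p
  | 0 => by
      refine LinearMap.ext fun x => ?_
      simp only [lam1, LinearMap.comp_apply, TensorProduct.mk_apply, LinearMap.rTensor_tmul,
        LinearMap.lTensor_tmul, Bialgebra.comul_one, Algebra.TensorProduct.one_def,
        LinearEquiv.coe_coe, TensorProduct.assoc_tmul]
  | p + 1 => codiagL_coassoc (Bialgebra.comulAlgHom k H) c.coassoc_assoc (lam1_coassoc p)

theorem splitLast_lam1 : ∀ p,
    (splitLast k A p).toLinearMap.lTensor H ∘ₗ lam1 k H A c (p + 1)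
      = codiagL H (lam1 k H A c p) c.lam.toLinearMap ∘ₗ (splitLast k A p).toLinearMap
  | 0 => by
      have h : (TensorProduct.comm k A k).toLinearMap.lTensor H ∘ₗ
          codiagL H c.lam.toLinearMap (TensorProduct.mk k H k 1)
          = codiagL H (TensorProduct.mk k H k 1) c.lam.toLinearMap ∘ₗ
            (TensorProduct.comm k A k).toLinearMap := by
        refine TensorProduct.ext' fun a r => ?_
        simp only [codiagL, LinearMap.comp_apply, LinearEquiv.coe_coe, TensorProduct.map_tmul,
          TensorProduct.comm_tmul]
        generalize c.lam.toLinearMap a = t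
        induction t with
        | zero => simp
        | add => simp_all [tmul_add, add_tmul]
        | tmul => simp
      exact h
  | p + 1 => splitStep_codiagL (splitLast_lam1 p)

theorem lam1_mulAt : ∀ s i,
    lam1 k H A c s ∘ₗ mulAt k A s i = (mulAt k A s i).lTensor H ∘ₗ lam1 k H A c (s + 1)
  | 0, _ => by simp [mulAt]
  | s + 1, 0 => by simp [mulAt]
  | s + 1, 1 => codiagL_mulHead c.lam (lam1 k H A c s)
  | s + 1, i + 2 => by
      have h1 := lTensor_map_codiagL c.lam.toLinearMap (lam1 k H A c (s + 1)) LinearMap.id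
        (mulAt k A s (i + 1))
      rw [LinearMap.lTensor_id, LinearMap.id_comp, ← lam1_mulAt s (i + 1)] at h1
      have h2 := codiagL_comp_map c.lam.toLinearMap (lam1 k H A c s) LinearMap.id
        (mulAt k A s (i + 1))
      exact h2.trans h1.symm

theorem splitLast_lam2 : ∀ p,
    (splitLast k H p).toLinearMap.rTensor A ∘ₗ lam2 k H A c (p + 1)
      = codiagR A (lam2 k H A c p) c.lam.toLinearMap ∘ₗ (splitLast k A p).toLinearMap
  | 0 => by
      have h : (TensorProduct.comm k H k).toLinearMap.rTensor A ∘ₗ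
          codiagR A c.lam.toLinearMap ((TensorProduct.mk k k A).flip 1)
          = codiagR A ((TensorProduct.mk k k A).flip 1) c.lam.toLinearMap ∘ₗ
            (TensorProduct.comm k A k).toLinearMap := by
        refine TensorProduct.ext' fun a r => ?_
        simp only [codiagR, LinearMap.comp_apply, LinearEquiv.coe_coe, TensorProduct.map_tmul,
          TensorProduct.comm_tmul]
        generalize c.lam.toLinearMap a = t
        induction t with
        | zero => simp
        | add => simp_all [tmul_add, add_tmul]
        | tmul => simp
      exact h
  | p + 1 => splitStep_codiagR (splitLast_lam2 p)

theorem lam2_mulAt : ∀ s i,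
    lam2 k H A c s ∘ₗ mulAt k A s i = (mulAt k H s i).rTensor A ∘ₗ lam2 k H A c (s + 1)
  | 0, _ => by simp [mulAt]
  | s + 1, 0 => by simp [mulAt]
  | s + 1, 1 => codiagR_mulHead c.lam (lam2 k H A c s)
  | s + 1, i + 2 => by
      have h1 := rTensor_map_codiagR c.lam.toLinearMap (lam2 k H A c (s + 1)) LinearMap.id
        (mulAt k H s (i + 1))
      rw [LinearMap.rTensor_id, LinearMap.id_comp, ← lam2_mulAt s (i + 1)] at h1
      have h2 := codiagR_comp_map c.lam.toLinearMap (lam2 k H A c s) LinearMap.id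
        (mulAt k A s (i + 1))
      exact h2.trans h1.symm

theorem coactl_lam2 : ∀ p,
    (TensorProduct.assoc k H (tpow k H p) A).toLinearMap ∘ₗ
      (coactl k H p).rTensor A ∘ₗ lam2 k H A c p
      = (lam2 k H A c p).lTensor H ∘ₗ lam1 k H A c p
  | 0 => rfl
  | p + 1 => codiag_compat c.coassoc_assoc (coactl_lam2 p)

theorem coactr_lam2 : ∀ p,
    (TensorProduct.assoc k (tpow k H p) H A).toLinearMap ∘ₗ
      (coactr k H p).rTensor A ∘ₗ lam2 k H A c p
      = c.lam.toLinearMap.lTensor (tpow k H p) ∘ₗ lam2 k H A c p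
  | 0 => by
      have h : (TensorProduct.assoc k k H A).toLinearMap ∘ₗ
          ((TensorProduct.mk k k H).flip 1).rTensor A ∘ₗ (TensorProduct.mk k k A).flip 1
          = c.lam.toLinearMap.lTensor k ∘ₗ (TensorProduct.mk k k A).flip 1 := by
        ext
        simp [Algebra.TensorProduct.one_def]
      exact h
  | p + 1 => codiagR_coassoc c.lam c.coassoc_assoc (coactr_lam2 p)

/-- `H` as a left comodule algebra over itself. -/
def selfComodAlg : ComodAlg k H H where
  lam := Bialgebra.comulAlgHom k H
  coassoc := by
    refine LinearMap.ext fun x => ?_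
    have h := LinearMap.congr_fun (comul_coassoc_assoc k H) x
    simp only [LinearMap.comp_apply, LinearEquiv.coe_coe] at h
    exact (LinearEquiv.eq_symm_apply _).2 h
  counital := Coalgebra.rTensor_counit_comp_comul

theorem codiagR_counit {N : Type} [AddCommGroup N] [Module k N]
    {m : N →ₗ[k] N ⊗[k] H}
    (hm : (TensorProduct.rid k N).toLinearMap ∘ₗ
      (Coalgebra.counit (R := k) (A := H)).lTensor N ∘ₗ m = LinearMap.id) :
    (TensorProduct.rid k (H ⊗[k] N)).toLinearMap ∘ₗ
      (Coalgebra.counit (R := k) (A := H)).lTensor (H ⊗[k] N) ∘ₗ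
        codiagR H (Coalgebra.comul (R := k) (A := H)) m = LinearMap.id := by
  have key : ∀ (s : H ⊗[k] H) (t : N ⊗[k] H),
      TensorProduct.rid k (H ⊗[k] N) ((Coalgebra.counit (R := k) (A := H)).lTensor (H ⊗[k] N)
        (codiagR H LinearMap.id LinearMap.id (s ⊗ₜ[k] t)))
      = TensorProduct.rid k H ((Coalgebra.counit (R := k) (A := H)).lTensor H s) ⊗ₜ[k]
        TensorProduct.rid k N ((Coalgebra.counit (R := k) (A := H)).lTensor N t) := by
    intro s t
    induction s with
    | zero => simp
    | add => simp_all [add_tmul]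
    | tmul c d =>
      induction t with
      | zero => simp
      | add => simp_all [tmul_add]
      | tmul c' d' => simp [codiagR, TensorProduct.smul_tmul', TensorProduct.tmul_smul, smul_smul, mul_comm]
  refine TensorProduct.ext' fun x y => ?_
  have h := key (Coalgebra.comul (R := k) x) (m y)
  have hy := LinearMap.congr_fun hm y
  simp only [LinearMap.comp_apply, LinearEquiv.coe_coe, LinearMap.id_apply] at hy
  rw [hy, Coalgebra.lTensor_counit_comul, TensorProduct.rid_tmul, one_smul] at h
  exact h

theorem counit_lam2_self : ∀ p, (TensorProduct.rid k (tpow k H p)).toLinearMap ∘ₗ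
    (Coalgebra.counit (R := k) (A := H)).lTensor (tpow k H p) ∘ₗ
      lam2 k H H (selfComodAlg k H) p = LinearMap.id
  | 0 => by
      refine LinearMap.ext fun x => ?_
      simp only [lam2, LinearMap.comp_apply, LinearMap.flip_apply, TensorProduct.mk_apply,
        LinearMap.lTensor_tmul, Bialgebra.counit_one, LinearEquiv.coe_coe, TensorProduct.rid_tmul,
        one_smul, LinearMap.id_apply]
  | p + 1 => codiagR_counit k H (counit_lam2_self p)

end IteratedCoactions

section LastCoface

variable {k : Type} [CommRing k] {H : Type} [Ring H] [HopfAlgebra k H]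
  {A : Type} [Ring A] [Algebra k A] (c : ComodAlg k H A)

section

variable {M M' N N' P : Type} [AddCommGroup M] [Module k M] [AddCommGroup N] [Module k N]
  [AddCommGroup M'] [Module k M'] [AddCommGroup N'] [Module k N'] [AddCommGroup P] [Module k P]

/-- The coaction of `A` on `M ⊗ A`, regrouped along `e : N ≃ M ⊗ H`. -/
def regroupCoaction (e : N ≃ₗ[k] M ⊗[k] H) : M ⊗[k] A →ₗ[k] N ⊗[k] A :=
  e.symm.toLinearMap.rTensor A ∘ₗ (TensorProduct.assoc k M H A).symm.toLinearMap ∘ₗ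
    c.lam.toLinearMap.lTensor M

theorem regroupCoaction_splitStep (e : N ≃ₗ[k] M ⊗[k] H) :
    regroupCoaction c (splitStep e) ∘ₗ (TensorProduct.assoc k H M A).symm.toLinearMap
      = (TensorProduct.assoc k H N A).symm.toLinearMap ∘ₗ (regroupCoaction c e).lTensor H := by
  refine TensorProduct.ext' fun h x => ?_
  induction x with
  | zero => simp
  | add => simp_all [tmul_add]
  | tmul m a =>
    simp only [regroupCoaction, splitStep, LinearMap.comp_apply, LinearEquiv.coe_coe,
      TensorProduct.assoc_symm_tmul, LinearMap.lTensor_tmul]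
    generalize c.lam.toLinearMap a = t
    induction t with
    | zero => simp
    | add => simp_all [tmul_add]
    | tmul => simp [LinearEquiv.trans_symm]

theorem regroupCoaction_natural {e : N ≃ₗ[k] M ⊗[k] H} {e' : N' ≃ₗ[k] M' ⊗[k] H}
    {f : N →ₗ[k] N'} {g : M →ₗ[k] M'}
    (h : e'.toLinearMap ∘ₗ f = g.rTensor H ∘ₗ e.toLinearMap) :
    regroupCoaction c e' ∘ₗ g.rTensor A = f.rTensor A ∘ₗ regroupCoaction c e := by
  refine TensorProduct.ext' fun m a => ?_
  simp only [regroupCoaction, LinearMap.comp_apply, LinearEquiv.coe_coe,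
    LinearMap.rTensor_tmul, LinearMap.lTensor_tmul]
  generalize c.lam.toLinearMap a = t
  induction t with
  | zero => simp
  | add => simp_all [tmul_add]
  | tmul x b =>
    have hx := LinearMap.congr_fun h (e.symm (m ⊗ₜ x))
    simp only [LinearMap.comp_apply, LinearEquiv.coe_coe, LinearEquiv.apply_symm_apply,
      LinearMap.rTensor_tmul] at hx
    simp [← hx]

theorem regroupCoaction_regroupCoaction {e : N ≃ₗ[k] M ⊗[k] H} {e' : P ≃ₗ[k] N ⊗[k] H}
    {f : N →ₗ[k] P}
    (h : e'.toLinearMap ∘ₗ f = e.symm.toLinearMap.rTensor H ∘ₗ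
      (TensorProduct.assoc k M H H).symm.toLinearMap ∘ₗ
      (Coalgebra.comul (R := k) (A := H)).lTensor M ∘ₗ e.toLinearMap) :
    regroupCoaction c e' ∘ₗ regroupCoaction c e = f.rTensor A ∘ₗ regroupCoaction c e := by
  refine TensorProduct.ext' fun m a => ?_
  let Φ : H ⊗[k] (H ⊗[k] A) →ₗ[k] P ⊗[k] A :=
    e'.symm.toLinearMap.rTensor A ∘ₗ (TensorProduct.assoc k N H A).symm.toLinearMap ∘ₗ
      (e.symm.toLinearMap ∘ₗ TensorProduct.mk k M H m).rTensor (H ⊗[k] A)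
  have hL : ∀ t : H ⊗[k] A, regroupCoaction c e' (e.symm.toLinearMap.rTensor A
      ((TensorProduct.assoc k M H A).symm (m ⊗ₜ[k] t))) = Φ (c.lam.toLinearMap.lTensor H t) := by
    intro t
    induction t with
    | zero => simp
    | add => simp_all [tmul_add]
    | tmul => simp [Φ, regroupCoaction]
  have hR : ∀ t : H ⊗[k] A, f.rTensor A (e.symm.toLinearMap.rTensor A
      ((TensorProduct.assoc k M H A).symm (m ⊗ₜ[k] t))) = Φ (TensorProduct.assoc k H H A
        ((Coalgebra.comul (R := k) (A := H)).rTensor A t)) := by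
    intro t
    induction t with
    | zero => simp
    | add => simp_all [tmul_add]
    | tmul x b =>
      have hx := LinearMap.congr_fun h (e.symm (m ⊗ₜ x))
      simp only [LinearMap.comp_apply, LinearEquiv.coe_coe, LinearEquiv.apply_symm_apply,
        LinearMap.lTensor_tmul] at hx
      rw [← LinearEquiv.eq_symm_apply] at hx
      simp only [TensorProduct.assoc_symm_tmul, LinearMap.rTensor_tmul, LinearEquiv.coe_coe, hx]
      generalize Coalgebra.comul (R := k) x = u
      induction u with
      | zero => simp
      | add => simp_all [tmul_add, add_tmul]
      | tmul => simp [Φ]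
  have h1 := LinearMap.congr_fun c.coassoc_assoc a
  simp only [LinearMap.comp_apply, LinearEquiv.coe_coe] at h1
  have h2 := hL (c.lam.toLinearMap a)
  rw [← h1, ← hR] at h2
  exact h2

end

theorem lastCoface_assoc_symm (q : ℕ) :
    lastCoface k H A c (q + 1) ∘ₗ (TensorProduct.assoc k H (tpow k H q) A).symm.toLinearMap
      = (TensorProduct.assoc k H (tpow k H (q + 1)) A).symm.toLinearMap ∘ₗ
        (lastCoface k H A c q).lTensor H :=
  regroupCoaction_splitStep c (splitLast k H q)

theorem lastCoface_comulAt {q a : ℕ} (h : a < q) :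
    lastCoface k H A c (q + 1) ∘ₗ (comulAt k H q (a + 1)).rTensor A
      = (comulAt k H (q + 1) (a + 1)).rTensor A ∘ₗ lastCoface k H A c q :=
  regroupCoaction_natural c (splitLast_comulAt k H q a h)

theorem lastCoface_lastCoface (q : ℕ) :
    lastCoface k H A c (q + 1) ∘ₗ lastCoface k H A c q
      = (comulAt k H (q + 1) (q + 1)).rTensor A ∘ₗ lastCoface k H A c q :=
  regroupCoaction_regroupCoaction c (splitLast_comulAt_last k H q)

end LastCoface

section AlternatingSum

variable {C C' D E : Type} [AddCommGroup C] [AddCommGroup C'] [AddCommGroup D]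
  [AddCommGroup E]

/-- The alternating sum of the first `n` maps of a sequence. -/
def altSum (n : ℕ) (d : ℕ → C →+ D) : C →+ D :=
  ∑ i ∈ Finset.range n, ((-1 : ℤ) ^ i) • d i

theorem altSum_apply (n : ℕ) (d : ℕ → C →+ D) (x : C) :
    altSum n d x = ∑ i ∈ Finset.range n, ((-1 : ℤ) ^ i) • d i x := by
  simp [altSum]

theorem sum_simplicial_eq_zero : ∀ (n : ℕ) (F : ℕ → ℕ → E),
    (∀ i j, i ≤ j → j < n → F (j + 1) i = F i j) →
    ∑ j ∈ Finset.range (n + 1), ∑ i ∈ Finset.range n, ((-1 : ℤ) ^ (j + i)) • F j i = 0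
  | 0, _, _ => by simp
  | n + 1, F, hF => by
      have ih := sum_simplicial_eq_zero n F fun i j hi hj => hF i j hi (by omega)
      rw [Finset.sum_range_succ, Finset.sum_congr rfl fun j _ => Finset.sum_range_succ _ n,
        Finset.sum_add_distrib, ih, zero_add, ← Finset.sum_add_distrib]
      refine Finset.sum_eq_zero fun i hi => ?_
      rw [hF i n (by simpa [Nat.lt_succ_iff] using hi) (by omega), ← add_smul]
      convert zero_smul ℤ _
      ring

theorem altSum_altSum_eq_zero {n : ℕ} {d : ℕ → C →+ D} {d' : ℕ → D →+ E} {x : C}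
    (h : ∀ i j, i ≤ j → j < n → d' (j + 1) (d i x) = d' i (d j x)) :
    altSum (n + 1) d' (altSum n d x) = 0 := by
  rw [← sum_simplicial_eq_zero n (fun j i => d' j (d i x)) h]
  simp only [altSum_apply, map_sum, map_zsmul, Finset.smul_sum, smul_smul, pow_add]
  rw [Finset.sum_comm]
  simp only [mul_comm]

theorem altSum_comm {m n : ℕ} {d : ℕ → C →+ D} {e : ℕ → C →+ C'} {d' : ℕ → C' →+ E}
    {e' : ℕ → D →+ E} {x : C}
    (h : ∀ i < m, ∀ j < n, d' i (e j x) = e' j (d i x)) :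
    altSum m d' (altSum n e x) = altSum n e' (altSum m d x) := by
  simp only [altSum_apply, map_sum, map_zsmul, Finset.smul_sum]
  refine (Finset.sum_congr rfl fun j hj => Finset.sum_congr rfl fun i hi => ?_).trans
    Finset.sum_comm
  rw [h i (Finset.mem_range.1 hi) j (Finset.mem_range.1 hj), smul_comm]

theorem map_altSum {n : ℕ} {d : ℕ → C →+ D} {d' : ℕ → C' →+ E} (F : C →+ C') (G : D →+ E) {x : C}
    (h : ∀ i < n, d' i (F x) = G (d i x)) :
    altSum n d' (F x) = G (altSum n d x) := by
  simp only [altSum_apply, map_sum, map_zsmul]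
  exact Finset.sum_congr rfl fun i hi => by rw [h i (Finset.mem_range.1 hi)]

end AlternatingSum

section HochschildFaces

variable {k : Type} [CommRing k] {A : Type} [Ring A] [Algebra k A]

section

variable {X M N : Type} [AddCommGroup X] [Module k X] [AddCommGroup M] [Module k M]
  [AddCommGroup N] [Module k N] {L R : A →ₗ[k] X →ₗ[k] X}

theorem lift_lTensor_mulHead (hL : ∀ a b x, L (a * b) x = L a (L b x)) (f : M →ₗ[k] X) :
    (TensorProduct.lift L ∘ₗ f.lTensor A) ∘ₗ mulHead A M
      = TensorProduct.lift L ∘ₗ (TensorProduct.lift L ∘ₗ f.lTensor A).lTensor A := by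
  ext a b x
  simp [mulHead, hL]

theorem lift_lTensor_comp (f : M →ₗ[k] X) (g : N →ₗ[k] M) :
    (TensorProduct.lift L ∘ₗ f.lTensor A) ∘ₗ g.lTensor A
      = TensorProduct.lift L ∘ₗ (f ∘ₗ g).lTensor A := by
  rw [LinearMap.lTensor_comp, LinearMap.comp_assoc]

theorem lift_splitStep (hLR : ∀ a b x, L a (R b x) = R b (L a x)) (f : M →ₗ[k] X)
    (e : N ≃ₗ[k] M ⊗[k] A) :
    TensorProduct.lift R.flip ∘ₗ (TensorProduct.lift L ∘ₗ f.lTensor A).rTensor A ∘ₗ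
        (splitStep e).toLinearMap
      = TensorProduct.lift L ∘ₗ
        (TensorProduct.lift R.flip ∘ₗ f.rTensor A ∘ₗ e.toLinearMap).lTensor A := by
  refine TensorProduct.ext' fun a y => ?_
  simp only [splitStep, LinearEquiv.trans_apply, LinearMap.comp_apply, LinearEquiv.coe_coe,
    TensorProduct.congr_tmul, LinearEquiv.refl_apply, LinearMap.lTensor_tmul,
    TensorProduct.lift.tmul]
  generalize e y = t
  induction t with
  | zero => simp
  | add => simp_all [tmul_add]
  | tmul u b => simp [hLR]

theorem lift_rTensor_comp {N' : Type} [AddCommGroup N'] [Module k N'] {f : M →ₗ[k] X}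
    {g : N →ₗ[k] M} {s : N' →ₗ[k] N ⊗[k] A} {t : N' →ₗ[k] M ⊗[k] A} (h : t = g.rTensor A ∘ₗ s) :
    TensorProduct.lift R.flip ∘ₗ (f ∘ₗ g).rTensor A ∘ₗ s
      = TensorProduct.lift R.flip ∘ₗ f.rTensor A ∘ₗ t := by
  rw [h, LinearMap.rTensor_comp, LinearMap.comp_assoc]

theorem lift_rTensor_mulLast (hR : ∀ a b x, R (a * b) x = R b (R a x)) {P : Type}
    [AddCommGroup P] [Module k P] (f : M →ₗ[k] X) {e : N →ₗ[k] M ⊗[k] A} {s : P →ₗ[k] N ⊗[k] A}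
    {t : P →ₗ[k] M ⊗[k] A}
    (h : t = (LinearMap.mul' k A).lTensor M ∘ₗ (TensorProduct.assoc k M A A).toLinearMap ∘ₗ
      e.rTensor A ∘ₗ s) :
    TensorProduct.lift R.flip ∘ₗ (TensorProduct.lift R.flip ∘ₗ f.rTensor A ∘ₗ e).rTensor A ∘ₗ s
      = TensorProduct.lift R.flip ∘ₗ f.rTensor A ∘ₗ t := by
  have key : TensorProduct.lift R.flip ∘ₗ (TensorProduct.lift R.flip ∘ₗ f.rTensor A).rTensor A
      = TensorProduct.lift R.flip ∘ₗ f.rTensor A ∘ₗ (LinearMap.mul' k A).lTensor M ∘ₗ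
        (TensorProduct.assoc k M A A).toLinearMap := by
    ext m a b
    simp [hR]
  subst h
  rw [← LinearMap.comp_assoc e, LinearMap.rTensor_comp]
  have := congrArg (fun g => g ∘ₗ e.rTensor A ∘ₗ s) key
  simpa only [LinearMap.comp_assoc] using this

end

variable {X : Type} [AddCommGroup X] [Module k X]

/-- The faces of the Hochschild complex of `A` with coefficients in `X`, for a left action `L` and
a right action `R`. -/
def hochschildFace (L R : A →ₗ[k] X →ₗ[k] X) (p i : ℕ) :
    (tpow k A p →ₗ[k] X) →+ (tpow k A (p + 1) →ₗ[k] X) :=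
  AddMonoidHom.mk' (fun f =>
    if i = 0 then TensorProduct.lift L ∘ₗ f.lTensor A
    else if i = p + 1 then
      TensorProduct.lift R.flip ∘ₗ f.rTensor A ∘ₗ (splitLast k A p).toLinearMap
    else f ∘ₗ mulAt k A p i) fun f g => by
      split_ifs
      · rw [LinearMap.lTensor_add]; exact LinearMap.comp_add _ _ _
      · rw [LinearMap.rTensor_add, LinearMap.add_comp, LinearMap.comp_add]
      · rw [LinearMap.add_comp]

variable {L R : A →ₗ[k] X →ₗ[k] X} {p : ℕ}

theorem hochschildFace_last (f : tpow k A p →ₗ[k] X) :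
    hochschildFace L R p (p + 1) f
      = TensorProduct.lift R.flip ∘ₗ f.rTensor A ∘ₗ (splitLast k A p).toLinearMap := by
  simp [hochschildFace]

theorem hochschildFace_mid {a : ℕ} (h : a < p) (f : tpow k A p →ₗ[k] X) :
    hochschildFace L R p (a + 1) f = f ∘ₗ mulAt k A p (a + 1) := by
  simp [hochschildFace, h.ne]

theorem hochschildFace_hochschildFace (hL : ∀ a b x, L (a * b) x = L a (L b x))
    (hR : ∀ a b x, R (a * b) x = R b (R a x)) (hLR : ∀ a b x, L a (R b x) = R b (L a x))
    (f : tpow k A p →ₗ[k] X) {i j : ℕ} (hij : i ≤ j) (hj : j < p + 2) :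
    hochschildFace L R (p + 1) (j + 1) (hochschildFace L R p i f)
      = hochschildFace L R (p + 1) i (hochschildFace L R p j f) := by
  rcases i with _ | a
  · rcases j with _ | b
    · rw [hochschildFace_mid (by omega)]
      exact lift_lTensor_mulHead hL f
    · rcases (show b ≤ p by omega).eq_or_lt with rfl | hb
      · rw [hochschildFace_last, hochschildFace_last]
        exact lift_splitStep hLR f (splitLast k A b)
      · rw [hochschildFace_mid (show b + 1 < p + 1 by omega), hochschildFace_mid hb]
        exact lift_lTensor_comp f (mulAt k A p (b + 1))
  · obtain ⟨b, rfl⟩ : ∃ b, j = b + 1 := ⟨j - 1, by omega⟩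
    rw [hochschildFace_mid (show a < p + 1 by omega)]
    rcases (show b ≤ p by omega).eq_or_lt with rfl | hb
    · rw [hochschildFace_last, hochschildFace_last]
      rcases (show a ≤ b by omega).eq_or_lt with rfl | ha
      · rw [hochschildFace_last]
        exact lift_rTensor_mulLast hR f (splitLast_mulAt_last k A a)
      · rw [hochschildFace_mid ha]
        exact lift_rTensor_comp (splitLast_mulAt k A b a ha)
    · rw [hochschildFace_mid (show b + 1 < p + 1 by omega), hochschildFace_mid hb,
        hochschildFace_mid (show a < p by omega), LinearMap.comp_assoc, LinearMap.comp_assoc,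
        mulAt_mulAt k A p a b (by omega) hb]

theorem Equivariant.hochschildFace_comp {Y : Type} [AddCommGroup Y] [Module k Y]
    {L' R' : A →ₗ[k] Y →ₗ[k] Y} {g : X →ₗ[k] Y} (hL : Equivariant L L' g) (hR : Equivariant R R' g)
    (f : tpow k A p →ₗ[k] X) (i : ℕ) :
    hochschildFace L' R' p i (g ∘ₗ f) = g ∘ₗ hochschildFace L R p i f := by
  simp only [hochschildFace, AddMonoidHom.mk'_apply]
  split_ifs
  · exact hL.lift_comp_lTensor f
  · rw [← LinearMap.comp_assoc, hR.lift_comp_rTensor f]; rfl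
  · rfl

end HochschildFaces

section CoactionFaces

variable {k : Type} [CommRing k] {H : Type} [Ring H] [HopfAlgebra k H]
  {A : Type} [Ring A] [Algebra k A]

section

variable {B M N K P : Type} [AddCommGroup B] [Module k B] [AddCommGroup M] [Module k M]
  [AddCommGroup N] [Module k N] [AddCommGroup K] [Module k K] [AddCommGroup P] [Module k P]

theorem comulHead_assoc_symm {l : N →ₗ[k] H ⊗[k] N}
    (hl : (TensorProduct.assoc k H H N).toLinearMap ∘ₗ
      (Coalgebra.comul (R := k) (A := H)).rTensor N ∘ₗ l = l.lTensor H ∘ₗ l)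
    (f : N →ₗ[k] M ⊗[k] B) :
    (comulHead H M).rTensor B ∘ₗ (TensorProduct.assoc k H M B).symm.toLinearMap ∘ₗ
        f.lTensor H ∘ₗ l
      = (TensorProduct.assoc k H (H ⊗[k] M) B).symm.toLinearMap ∘ₗ
        ((TensorProduct.assoc k H M B).symm.toLinearMap ∘ₗ f.lTensor H ∘ₗ l).lTensor H ∘ₗ l := by
  have key : (comulHead H M).rTensor B ∘ₗ (TensorProduct.assoc k H M B).symm.toLinearMap
      = (TensorProduct.assoc k H (H ⊗[k] M) B).symm.toLinearMap ∘ₗ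
        ((TensorProduct.assoc k H M B).symm.toLinearMap).lTensor H ∘ₗ
        (TensorProduct.assoc k H H (M ⊗[k] B)).toLinearMap ∘ₗ
        (Coalgebra.comul (R := k) (A := H)).rTensor (M ⊗[k] B) := by
    ext x m b
    simp only [comulHead, TensorProduct.AlgebraTensorModule.curry_apply,
      TensorProduct.curry_apply, LinearMap.coe_restrictScalars, LinearMap.comp_apply,
      LinearEquiv.coe_coe,
      TensorProduct.assoc_symm_tmul, LinearMap.rTensor_tmul]
    generalize Coalgebra.comul (R := k) x = t
    induction t with
    | zero => simp
    | add => simp_all [add_tmul]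
    | tmul y z => simp
  have nat : (TensorProduct.assoc k H H (M ⊗[k] B)).toLinearMap ∘ₗ
        (Coalgebra.comul (R := k) (A := H)).rTensor (M ⊗[k] B) ∘ₗ f.lTensor H
      = (f.lTensor H).lTensor H ∘ₗ (TensorProduct.assoc k H H N).toLinearMap ∘ₗ
        (Coalgebra.comul (R := k) (A := H)).rTensor N := by
    refine TensorProduct.ext' fun x n => ?_
    simp only [LinearMap.comp_apply, LinearMap.rTensor_tmul, LinearMap.lTensor_tmul]
    generalize Coalgebra.comul (R := k) x = t
    induction t with
    | zero => simp
    | add => simp_all [add_tmul]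
    | tmul y z => simp
  refine LinearMap.ext fun n => ?_
  have h₁ := LinearMap.congr_fun key (f.lTensor H (l n))
  have h₂ := LinearMap.congr_fun nat (l n)
  have h₃ := LinearMap.congr_fun hl n
  simp only [LinearMap.comp_apply, LinearEquiv.coe_coe] at h₁ h₂ h₃
  simp only [LinearMap.lTensor_comp, LinearMap.comp_apply, LinearEquiv.coe_coe]
  rw [h₁, h₂, h₃]

theorem rTensor_lTensor_assoc_symm (g : M →ₗ[k] K) (f : N →ₗ[k] M ⊗[k] B) (l : P →ₗ[k] H ⊗[k] N) :
    (g.lTensor H).rTensor B ∘ₗ (TensorProduct.assoc k H M B).symm.toLinearMap ∘ₗ f.lTensor H ∘ₗ l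
      = (TensorProduct.assoc k H K B).symm.toLinearMap ∘ₗ (g.rTensor B ∘ₗ f).lTensor H ∘ₗ l := by
  have key : (g.lTensor H).rTensor B ∘ₗ (TensorProduct.assoc k H M B).symm.toLinearMap
      = (TensorProduct.assoc k H K B).symm.toLinearMap ∘ₗ (g.rTensor B).lTensor H := by
    ext; simp
  rw [LinearMap.lTensor_comp, LinearMap.comp_assoc, ← LinearMap.comp_assoc, key,
    LinearMap.comp_assoc]

theorem comp_lTensor_comp {Q Q' S S' : Type} [AddCommGroup Q] [Module k Q] [AddCommGroup Q']
    [Module k Q'] [AddCommGroup S] [Module k S] [AddCommGroup S'] [Module k S']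
    {e : H ⊗[k] Q →ₗ[k] S} {e' : H ⊗[k] Q' →ₗ[k] S'} {g : Q →ₗ[k] Q'} {g' : S →ₗ[k] S'}
    (h : g' ∘ₗ e = e' ∘ₗ g.lTensor H) (f : N →ₗ[k] Q) (l : P →ₗ[k] H ⊗[k] N) :
    g' ∘ₗ e ∘ₗ f.lTensor H ∘ₗ l = e' ∘ₗ (g ∘ₗ f).lTensor H ∘ₗ l := by
  rw [LinearMap.lTensor_comp, LinearMap.comp_assoc, ← LinearMap.comp_assoc, h,
    LinearMap.comp_assoc]

end

variable (c : ComodAlg k H A)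

/-- The vertical faces of the complex `C^{p,q}(A)`. -/
def coactionFace (p q i : ℕ) :
    (tpow k A p →ₗ[k] tpow k H q ⊗[k] A) →+ (tpow k A p →ₗ[k] tpow k H (q + 1) ⊗[k] A) :=
  AddMonoidHom.mk' (fun f =>
    if i = 0 then
      (TensorProduct.assoc k H (tpow k H q) A).symm.toLinearMap ∘ₗ f.lTensor H ∘ₗ lam1 k H A c p
    else if i = q + 1 then lastCoface k H A c q ∘ₗ f
    else (comulAt k H q i).rTensor A ∘ₗ f) fun f g => by
      split_ifs
      · rw [LinearMap.lTensor_add, LinearMap.add_comp]; exact LinearMap.comp_add _ _ _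
      · rw [LinearMap.comp_add]
      · rw [LinearMap.comp_add]

variable {p q : ℕ}

theorem coactionFace_zero (f : tpow k A p →ₗ[k] tpow k H q ⊗[k] A) :
    coactionFace c p q 0 f = (TensorProduct.assoc k H (tpow k H q) A).symm.toLinearMap ∘ₗ
      f.lTensor H ∘ₗ lam1 k H A c p := rfl

theorem coactionFace_last (f : tpow k A p →ₗ[k] tpow k H q ⊗[k] A) :
    coactionFace c p q (q + 1) f = lastCoface k H A c q ∘ₗ f := by
  simp [coactionFace]

theorem coactionFace_mid {a : ℕ} (h : a < q) (f : tpow k A p →ₗ[k] tpow k H q ⊗[k] A) :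
    coactionFace c p q (a + 1) f = (comulAt k H q (a + 1)).rTensor A ∘ₗ f := by
  simp [coactionFace, h.ne]

theorem coactionFace_coactionFace (f : tpow k A p →ₗ[k] tpow k H q ⊗[k] A) {i j : ℕ}
    (hij : i ≤ j) (hj : j < q + 2) :
    coactionFace c p (q + 1) (j + 1) (coactionFace c p q i f)
      = coactionFace c p (q + 1) i (coactionFace c p q j f) := by
  rcases i with _ | a
  · rcases j with _ | b
    · rw [coactionFace_mid c (by omega)]
      exact comulHead_assoc_symm (lam1_coassoc k H A c p) f
    · rcases (show b ≤ q by omega).eq_or_lt with rfl | hb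
      · rw [coactionFace_last, coactionFace_last]
        exact comp_lTensor_comp (lastCoface_assoc_symm c b) f (lam1 k H A c p)
      · rw [coactionFace_mid c (show b + 1 < q + 1 by omega), coactionFace_mid c hb]
        exact rTensor_lTensor_assoc_symm (comulAt k H q (b + 1)) f (lam1 k H A c p)
  · obtain ⟨b, rfl⟩ : ∃ b, j = b + 1 := ⟨j - 1, by omega⟩
    rw [coactionFace_mid c (show a < q + 1 by omega)]
    rcases (show b ≤ q by omega).eq_or_lt with rfl | hb
    · rw [coactionFace_last, coactionFace_last, ← LinearMap.comp_assoc]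
      rcases (show a ≤ b by omega).eq_or_lt with rfl | ha
      · rw [coactionFace_last, ← LinearMap.comp_assoc, lastCoface_lastCoface]
      · rw [coactionFace_mid c ha, ← LinearMap.comp_assoc, lastCoface_comulAt c ha]
    · rw [coactionFace_mid c (show b + 1 < q + 1 by omega), coactionFace_mid c hb,
        coactionFace_mid c (show a < q by omega), ← LinearMap.comp_assoc, ← LinearMap.comp_assoc,
        ← LinearMap.rTensor_comp, ← LinearMap.rTensor_comp,
        comulAt_comulAt k H q a b (by omega) hb]

end CoactionFaces

section MixedFaces

variable {k : Type} [CommRing k] {H : Type} [Ring H] [HopfAlgebra k H]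
  {A : Type} [Ring A] [Algebra k A]

section

variable {N X Y P : Type} [AddCommGroup N] [Module k N] [AddCommGroup X] [Module k X]
  [AddCommGroup Y] [Module k Y] [AddCommGroup P] [Module k P]
  {ρ : A →ₗ[k] H ⊗[k] A} {L : A →ₗ[k] Y →ₗ[k] Y} {L' : A →ₗ[k] X →ₗ[k] X} {e : X ≃ₗ[k] H ⊗[k] Y}

theorem lift_lTensor_coaction
    (h : Equivariant L' (diagAct ρ (LinearMap.mul k H) L) e.toLinearMap)
    (l : N →ₗ[k] H ⊗[k] N) (f : N →ₗ[k] Y) :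
    TensorProduct.lift L' ∘ₗ (e.symm.toLinearMap ∘ₗ f.lTensor H ∘ₗ l).lTensor A
      = e.symm.toLinearMap ∘ₗ
        (TensorProduct.lift L ∘ₗ f.lTensor A).lTensor H ∘ₗ codiagL H ρ l := by
  rw [lift_lTensor_codiagL, h.symm.lift_comp_lTensor]

theorem lift_rTensor_coaction
    (h : Equivariant L' (diagAct ρ (LinearMap.mul k H).flip L) e.toLinearMap)
    (l : N →ₗ[k] H ⊗[k] N) (f : N →ₗ[k] Y) {s : P →ₗ[k] N ⊗[k] A} {l' : P →ₗ[k] H ⊗[k] P}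
    (hs : s.lTensor H ∘ₗ l' = codiagL H l ρ ∘ₗ s) :
    TensorProduct.lift L'.flip ∘ₗ (e.symm.toLinearMap ∘ₗ f.lTensor H ∘ₗ l).rTensor A ∘ₗ s
      = e.symm.toLinearMap ∘ₗ
        (TensorProduct.lift L.flip ∘ₗ f.rTensor A ∘ₗ s).lTensor H ∘ₗ l' := by
  rw [← LinearMap.comp_assoc s, ← LinearMap.comp_assoc s, LinearMap.lTensor_comp,
    LinearMap.comp_assoc l', hs, h.symm.lift_comp_rTensor, ← LinearMap.comp_assoc s,
    lift_rTensor_codiagL]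
  rfl

end

variable (c : ComodAlg k H A) {p q : ℕ}

theorem hochschildFace_coactionFace (f : tpow k A p →ₗ[k] tpow k H q ⊗[k] A) {i j : ℕ}
    (hi : i < p + 2) (hj : j < q + 2) :
    hochschildFace (leftActA k H A c (q + 1)) (rightActA k H A c (q + 1)) p i
        (coactionFace c p q j f)
      = coactionFace c (p + 1) q j
        (hochschildFace (leftActA k H A c q) (rightActA k H A c q) p i f) := by
  rcases j with _ | b
  · rcases i with _ | a
    · exact lift_lTensor_coaction (equivariant_assoc_leftActA k H A c q) (lam1 k H A c p) f
    · rcases (show a ≤ p by omega).eq_or_lt with rfl | ha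
      · rw [hochschildFace_last, hochschildFace_last]
        exact lift_rTensor_coaction (equivariant_assoc_rightActA k H A c q) (lam1 k H A c a) f
          (splitLast_lam1 k H A c a)
      · rw [hochschildFace_mid ha, hochschildFace_mid ha, coactionFace_zero c (f ∘ₗ _),
          LinearMap.lTensor_comp]
        exact congrArg (fun t => (TensorProduct.assoc k H (tpow k H q) A).symm.toLinearMap ∘ₗ
          f.lTensor H ∘ₗ t) (lam1_mulAt k H A c p (a + 1))
  · rcases (show b ≤ q by omega).eq_or_lt with rfl | hb
    · rw [coactionFace_last, coactionFace_last]
      exact (equivariant_lastCoface_leftActA k H A c b).hochschildFace_comp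
        (equivariant_lastCoface_rightActA k H A c b) f i
    · rw [coactionFace_mid c hb, coactionFace_mid c hb]
      exact (equivariant_comulAt_leftActA k H A c q (b + 1)).hochschildFace_comp
        (equivariant_comulAt_rightActA k H A c q (b + 1)) f i

end MixedFaces

section Transfer

variable {k : Type} [CommRing k] {H : Type} [Ring H] [HopfAlgebra k H]
  {A : Type} [Ring A] [Algebra k A]

section

variable {N P K K' X X' : Type} [AddCommGroup N] [Module k N] [AddCommGroup P] [Module k P]
  [AddCommGroup K] [Module k K] [AddCommGroup K'] [Module k K'] [AddCommGroup X] [Module k X]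
  [AddCommGroup X'] [Module k X']

theorem lift_rTensor_transfer {ρ : A →ₗ[k] H ⊗[k] A} {m : N →ₗ[k] K ⊗[k] A}
    {m' : P →ₗ[k] K' ⊗[k] A} {s : P →ₗ[k] N ⊗[k] A} {t : K' →ₗ[k] K ⊗[k] H}
    (h : t.rTensor A ∘ₗ m' = codiagR A m ρ ∘ₗ s) (g : K →ₗ[k] X) (L : H →ₗ[k] X →ₗ[k] X) :
    TensorProduct.lift (diagAct ρ L (LinearMap.mul k A).flip).flip ∘ₗ
        (g.rTensor A ∘ₗ m).rTensor A ∘ₗ s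
      = (TensorProduct.lift L.flip ∘ₗ g.rTensor H ∘ₗ t).rTensor A ∘ₗ m' := by
  rw [← LinearMap.comp_assoc s, ← lift_rTensor_codiagR, LinearMap.comp_assoc, ← h,
    ← LinearMap.comp_assoc t, LinearMap.rTensor_comp _ _ t, LinearMap.comp_assoc]

theorem assoc_symm_transfer {l : N →ₗ[k] H ⊗[k] N} {m : N →ₗ[k] K ⊗[k] A}
    {d : K →ₗ[k] H ⊗[k] K}
    (h : (TensorProduct.assoc k H K A).toLinearMap ∘ₗ d.rTensor A ∘ₗ m = m.lTensor H ∘ₗ l)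
    (g : K →ₗ[k] X) :
    (TensorProduct.assoc k H X A).symm.toLinearMap ∘ₗ (g.rTensor A ∘ₗ m).lTensor H ∘ₗ l
      = (g.lTensor H ∘ₗ d).rTensor A ∘ₗ m := by
  have key : (TensorProduct.assoc k H X A).symm.toLinearMap ∘ₗ (g.rTensor A).lTensor H ∘ₗ
      (TensorProduct.assoc k H K A).toLinearMap = (g.lTensor H).rTensor A := by
    ext; simp
  rw [LinearMap.lTensor_comp, LinearMap.comp_assoc, ← h, LinearMap.rTensor_comp, ← key]
  rfl

theorem coaction_transfer {ρ : A →ₗ[k] H ⊗[k] A} {m : N →ₗ[k] K ⊗[k] A} {r : K →ₗ[k] K ⊗[k] H}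
    (h : (TensorProduct.assoc k K H A).toLinearMap ∘ₗ r.rTensor A ∘ₗ m = ρ.lTensor K ∘ₗ m)
    (g : K →ₗ[k] X) (s : X ⊗[k] H →ₗ[k] X') :
    (s.rTensor A ∘ₗ (TensorProduct.assoc k X H A).symm.toLinearMap ∘ₗ ρ.lTensor X) ∘ₗ
        g.rTensor A ∘ₗ m
      = (s ∘ₗ g.rTensor H ∘ₗ r).rTensor A ∘ₗ m := by
  have nat : ρ.lTensor X ∘ₗ g.rTensor A = g.rTensor (H ⊗[k] A) ∘ₗ ρ.lTensor K := by
    ext; simp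
  have key : (TensorProduct.assoc k X H A).symm.toLinearMap ∘ₗ g.rTensor (H ⊗[k] A) ∘ₗ
      (TensorProduct.assoc k K H A).toLinearMap = (g.rTensor H).rTensor A := by
    ext; simp
  calc _ = s.rTensor A ∘ₗ (TensorProduct.assoc k X H A).symm.toLinearMap ∘ₗ
        (ρ.lTensor X ∘ₗ g.rTensor A) ∘ₗ m := rfl
    _ = s.rTensor A ∘ₗ (TensorProduct.assoc k X H A).symm.toLinearMap ∘ₗ
        g.rTensor (H ⊗[k] A) ∘ₗ (ρ.lTensor K ∘ₗ m) := by rw [nat]; rfl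
    _ = s.rTensor A ∘ₗ ((TensorProduct.assoc k X H A).symm.toLinearMap ∘ₗ
        g.rTensor (H ⊗[k] A) ∘ₗ (TensorProduct.assoc k K H A).toLinearMap) ∘ₗ
        r.rTensor A ∘ₗ m := by rw [← h]; rfl
    _ = _ := by rw [key, LinearMap.rTensor_comp, LinearMap.rTensor_comp]; rfl

end

/-- The vertical faces of the bialgebra complex `C^{p,q}(H)`. -/
def bialgebraFace (k : Type) [CommRing k] (H : Type) [Ring H] [HopfAlgebra k H] (p q i : ℕ) :
    (tpow k H p →ₗ[k] tpow k H q) →+ (tpow k H p →ₗ[k] tpow k H (q + 1)) :=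
  AddMonoidHom.mk' (fun g =>
    if i = 0 then g.lTensor H ∘ₗ coactl k H p
    else if i = q + 1 then (splitLast k H q).symm.toLinearMap ∘ₗ g.rTensor H ∘ₗ coactr k H p
    else comulAt k H q i ∘ₗ g) fun f g => by
      split_ifs
      · rw [LinearMap.lTensor_add]; exact LinearMap.add_comp _ _ _
      · rw [LinearMap.rTensor_add, LinearMap.add_comp, LinearMap.comp_add]
      · rw [LinearMap.comp_add]

variable (c : ComodAlg k H A)

/-- The map `C^{p,q}(H) → C^{p,q}(A)` sending `g` to `(g ⊗ id_A) ∘ λ^p₂`. -/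
def transfer (p q : ℕ) :
    (tpow k H p →ₗ[k] tpow k H q) →+ (tpow k A p →ₗ[k] tpow k H q ⊗[k] A) :=
  AddMonoidHom.mk' (fun g => g.rTensor A ∘ₗ lam2 k H A c p) fun f g => by
    rw [LinearMap.rTensor_add, LinearMap.add_comp]

variable {p q : ℕ}

theorem transfer_apply (g : tpow k H p →ₗ[k] tpow k H q) :
    transfer c p q g = g.rTensor A ∘ₗ lam2 k H A c p := rfl

theorem hochschildFace_transfer (g : tpow k H p →ₗ[k] tpow k H q) {i : ℕ} (hi : i < p + 2) :
    hochschildFace (leftActA k H A c q) (rightActA k H A c q) p i (transfer c p q g)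
      = transfer c (p + 1) q (hochschildFace (leftAct k H q) (rightAct k H q) p i g) := by
  rcases i with _ | a
  · exact (lift_lTensor_codiagR c.lam.toLinearMap (lam2 k H A c p) g (leftAct k H q)).symm
  · rcases (show a ≤ p by omega).eq_or_lt with rfl | ha
    · rw [hochschildFace_last, hochschildFace_last]
      exact lift_rTensor_transfer (splitLast_lam2 k H A c a) g (rightAct k H q)
    · rw [hochschildFace_mid ha, hochschildFace_mid ha, transfer_apply, transfer_apply,
        LinearMap.comp_assoc, lam2_mulAt, LinearMap.rTensor_comp, LinearMap.comp_assoc]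

theorem coactionFace_transfer (g : tpow k H p →ₗ[k] tpow k H q) (i : ℕ) :
    coactionFace c p q i (transfer c p q g) = transfer c p (q + 1) (bialgebraFace k H p q i g) := by
  simp only [coactionFace, bialgebraFace, transfer, AddMonoidHom.mk'_apply]
  split_ifs
  · exact assoc_symm_transfer (coactl_lam2 k H A c p) g
  · exact coaction_transfer (coactr_lam2 k H A c p) g (splitLast k H q).symm.toLinearMap
  · rw [LinearMap.rTensor_comp, LinearMap.comp_assoc]

theorem transfer_self_injective :
    Function.Injective (transfer (selfComodAlg k H) p q) := by
  have key (g : tpow k H p →ₗ[k] tpow k H q) : (TensorProduct.rid k (tpow k H q)).toLinearMap ∘ₗ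
      (Coalgebra.counit (R := k) (A := H)).lTensor (tpow k H q) ∘ₗ
        transfer (selfComodAlg k H) p q g = g := by
    have nat : (TensorProduct.rid k (tpow k H q)).toLinearMap ∘ₗ
        (Coalgebra.counit (R := k) (A := H)).lTensor (tpow k H q) ∘ₗ g.rTensor H
        = g ∘ₗ (TensorProduct.rid k (tpow k H p)).toLinearMap ∘ₗ
          (Coalgebra.counit (R := k) (A := H)).lTensor (tpow k H p) :=
      TensorProduct.ext' fun x y => by simp
    have h := congrArg (fun t => g ∘ₗ t) (counit_lam2_self k H p)
    have h' := congrArg (fun t => t ∘ₗ lam2 k H H (selfComodAlg k H) p) nat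
    exact h'.trans h
  intro g g' h
  rw [← key g, h, key g']

end Transfer

section Differentials

variable {k : Type} [CommRing k] {H : Type} [Ring H] [HopfAlgebra k H]
  {A : Type} [Ring A] [Algebra k A] (c : ComodAlg k H A) {p q : ℕ}

theorem dhA_eq_altSum (f : tpow k A p →ₗ[k] tpow k H q ⊗[k] A) :
    dhA k H A c p q f
      = altSum (p + 2) (hochschildFace (leftActA k H A c q) (rightActA k H A c q) p) f := by
  rw [altSum_apply, dhA, betaL_eq_lift, betaR_eq_lift]
  rfl

theorem dvA_eq_altSum (f : tpow k A p →ₗ[k] tpow k H q ⊗[k] A) :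
    dvA k H A c p q f = altSum (q + 2) (coactionFace c p q) f := by
  rw [altSum_apply]
  rfl

theorem dhH_eq_altSum (g : tpow k H p →ₗ[k] tpow k H q) :
    dhH k H p q g = altSum (p + 2) (hochschildFace (leftAct k H q) (rightAct k H q) p) g := by
  rw [altSum_apply, dhH, lact_eq_lift, ract_eq_lift]
  rfl

theorem dvH_eq_altSum (g : tpow k H p →ₗ[k] tpow k H q) :
    dvH k H p q g = altSum (q + 2) (bialgebraFace k H p q) g := by
  rw [altSum_apply]
  rfl

theorem dhA_dhA (f : tpow k A p →ₗ[k] tpow k H q ⊗[k] A) :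
    dhA k H A c (p + 1) q (dhA k H A c p q f) = 0 := by
  rw [dhA_eq_altSum, dhA_eq_altSum]
  exact altSum_altSum_eq_zero fun i j hij hj => hochschildFace_hochschildFace
    (leftActA_mul k H A c q) (rightActA_mul k H A c q) (leftActA_rightActA k H A c q) f hij hj

theorem dvA_dvA (f : tpow k A p →ₗ[k] tpow k H q ⊗[k] A) :
    dvA k H A c p (q + 1) (dvA k H A c p q f) = 0 := by
  rw [dvA_eq_altSum, dvA_eq_altSum]
  exact altSum_altSum_eq_zero fun i j hij hj => coactionFace_coactionFace c f hij hj

theorem dhA_dvA (f : tpow k A p →ₗ[k] tpow k H q ⊗[k] A) :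
    dhA k H A c p (q + 1) (dvA k H A c p q f) = dvA k H A c (p + 1) q (dhA k H A c p q f) := by
  rw [dhA_eq_altSum, dvA_eq_altSum, dhA_eq_altSum, dvA_eq_altSum]
  exact altSum_comm fun i hi j hj => hochschildFace_coactionFace c f hi hj

theorem dhA_transfer (g : tpow k H p →ₗ[k] tpow k H q) :
    dhA k H A c p q (transfer c p q g) = transfer c (p + 1) q (dhH k H p q g) := by
  rw [dhA_eq_altSum, dhH_eq_altSum]
  exact map_altSum _ _ fun i hi => hochschildFace_transfer c g hi

theorem dvA_transfer (g : tpow k H p →ₗ[k] tpow k H q) :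
    dvA k H A c p q (transfer c p q g) = transfer c p (q + 1) (dvH k H p q g) := by
  rw [dvA_eq_altSum, dvH_eq_altSum]
  exact map_altSum _ _ fun i _ => coactionFace_transfer c g i

theorem dhH_dhH (g : tpow k H p →ₗ[k] tpow k H q) :
    dhH k H (p + 1) q (dhH k H p q g) = 0 := by
  apply transfer_self_injective
  rw [← dhA_transfer, ← dhA_transfer, dhA_dhA, map_zero]

theorem dvH_dvH (g : tpow k H p →ₗ[k] tpow k H q) :
    dvH k H p (q + 1) (dvH k H p q g) = 0 := by
  apply transfer_self_injective
  rw [← dvA_transfer, ← dvA_transfer, dvA_dvA, map_zero]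

theorem dhH_dvH (g : tpow k H p →ₗ[k] tpow k H q) :
    dhH k H p (q + 1) (dvH k H p q g) = dvH k H (p + 1) q (dhH k H p q g) := by
  apply transfer_self_injective
  rw [← dhA_transfer, ← dvA_transfer, dhA_dvA, ← dvA_transfer, ← dhA_transfer]

theorem dv_fst (z : Cbi k H A p q) :
    (dv k H A c p q z).1 = dvA k H A c p q z.1 + ((-1 : ℤ) ^ q) • transfer c p (q + 1) z.2 := rfl

theorem dhA_add_zsmul (f f' : tpow k A p →ₗ[k] tpow k H q ⊗[k] A) (n : ℤ) :
    dhA k H A c p q (f + n • f') = dhA k H A c p q f + n • dhA k H A c p q f' := by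
  simp only [dhA_eq_altSum, map_add, map_zsmul]

theorem dvA_add_zsmul (f f' : tpow k A p →ₗ[k] tpow k H q ⊗[k] A) (n : ℤ) :
    dvA k H A c p q (f + n • f') = dvA k H A c p q f + n • dvA k H A c p q f' := by
  simp only [dvA_eq_altSum, map_add, map_zsmul]

end Differentials

/-- **Statement 5** (Lemma: the deformation bicomplex).
For a bialgebra `H` and a left `H`-comodule algebra `A`, the data
`𝒞^{p,q}(A,H) = C^{p,q}(A) ⊕ C^{p,q+1}(H)` with the differentials `d^h, d^v` above
is a bicomplex: `d^h∘d^h = 0`, `d^v∘d^v = 0` and `d^h∘d^v = d^v∘d^h` (so that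
`(𝒞^{p,q}, d^h, (−1)^p d^v)` is a double complex). -/
theorem stmt_5 (k : Type) [Field k]
    (H : Type) [Ring H] [HopfAlgebra k H]
    (A : Type) [Ring A] [Algebra k A] (c : ComodAlg k H A)
    (p q : ℕ) (hp : 1 ≤ p) (z : Cbi k H A p q) :
    dh k H A c (p + 1) q (dh k H A c p q z) = 0 ∧
    dv k H A c p (q + 1) (dv k H A c p q z) = 0 ∧
    dh k H A c p (q + 1) (dv k H A c p q z) = dv k H A c (p + 1) q (dh k H A c p q z) := by
  refine ⟨Prod.ext (dhA_dhA c z.1) (dhH_dhH z.2), Prod.ext ?_ (dvH_dvH z.2),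
    Prod.ext ?_ (dhH_dvH z.2)⟩
  · change dvA k H A c p (q + 1) (dv k H A c p q z).1
      + ((-1 : ℤ) ^ (q + 1)) • transfer c p (q + 2) (dvH k H p (q + 1) z.2) = 0
    rw [dv_fst, dvA_add_zsmul, dvA_dvA, dvA_transfer, zero_add, ← add_smul, pow_succ, mul_neg_one,
      add_neg_cancel, zero_smul]
  · change dhA k H A c p (q + 1) (dv k H A c p q z).1
      = dvA k H A c (p + 1) q (dhA k H A c p q z.1)
        + ((-1 : ℤ) ^ q) • transfer c (p + 1) (q + 1) (dhH k H p (q + 1) z.2)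
    rw [dv_fst, dhA_add_zsmul, dhA_dvA, dhA_transfer]

end HopfPaper
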